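/- arXiv:1804.01316 — 7 statements merged into one kernel-verified Lean document; each statement's English description precedes it below -/
import Mathlib

section
/- Let ℓ, m, n be positive integers with gcd(ℓ,m,n) = 1 that are in Herzog's case (H1) with data a₁,a₂,b₁,b₂,c₁,c₂. Then ℓ = b₁c₁ + b₁c₂ + b₂c₂, m = a₁c₁ + a₂c₁ + a₂c₂ and n = a₁b₁ + a₁b₂ + a₂b₂. (Lemma 6(a)) -/
/-- Positive integers `ℓ, m, n` with `gcd(ℓ,m,n) = 1` are in Herzog's case (H1) with data
`a₁, a₂, b₁, b₂, c₁, c₂`. -/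
def HerzogH1 (ℓ m n a₁ a₂ b₁ b₂ c₁ c₂ : ℕ) : Prop :=
  0 < ℓ ∧ 0 < m ∧ 0 < n ∧ Nat.gcd (Nat.gcd ℓ m) n = 1 ∧
  0 < a₁ ∧ 0 < a₂ ∧ 0 < b₁ ∧ 0 < b₂ ∧ 0 < c₁ ∧ 0 < c₂ ∧
  (a₁ + a₂) * ℓ = b₁ * m + c₂ * n ∧
  (b₁ + b₂) * m = a₂ * ℓ + c₁ * n ∧
  (c₁ + c₂) * n = a₁ * ℓ + b₂ * m ∧
  IsLeast {k | 0 < k ∧ k * ℓ ∈ AddSubmonoid.closure ({m, n} : Set ℕ)} (a₁ + a₂) ∧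
  IsLeast {k | 0 < k ∧ k * m ∈ AddSubmonoid.closure ({ℓ, n} : Set ℕ)} (b₁ + b₂) ∧
  IsLeast {k | 0 < k ∧ k * n ∈ AddSubmonoid.closure ({ℓ, m} : Set ℕ)} (c₁ + c₂)

/-- Minimality over the integers. -/
lemma h1_min {p q r A : ℕ}
    (h : IsLeast {k | 0 < k ∧ k * p ∈ AddSubmonoid.closure ({q, r} : Set ℕ)} A)
    (x y z : ℤ) (hx : 0 < x) (hy : y ≤ 0) (hz : z ≤ 0) (e : x * p + y * q + z * r = 0) :
    (A : ℤ) ≤ x := by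
  obtain ⟨X, rfl⟩ := Int.eq_ofNat_of_zero_le hx.le
  obtain ⟨Y, hY⟩ := Int.eq_ofNat_of_zero_le (neg_nonneg.2 hy)
  obtain ⟨Z, hZ⟩ := Int.eq_ofNat_of_zero_le (neg_nonneg.2 hz)
  have e2 : X * p = Y * q + Z * r := by
    zify
    rw [← hY, ← hZ]
    linarith
  have : A ≤ X := by
    apply h.2
    refine ⟨by exact_mod_cast hx, ?_⟩
    rw [e2, AddSubmonoid.mem_closure_pair]
    exact ⟨Y, Z, by simp⟩
  exact_mod_cast this

/-- Subtracting a minimal relation decreases the weight. -/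
lemma h1_dec {p q r A B C x y z : ℤ} (hp : 0 < p) (hq : 0 < q) (hr : 0 < r)
    (hA : A * p = B * q + C * r) (hB : 0 < B) (hC : 0 < C) (hA0 : 0 < A)
    (hx : A ≤ x) (hy : y ≤ 0) (hz : z ≤ 0) (e : x * p + y * q + z * r = 0) :
    |x - A| * p + |y + B| * q + |z + C| * r < |x| * p + |y| * q + |z| * r := by
  have h1 : |x - A| = x - A := abs_of_nonneg (by linarith)
  have h2 : |x| = x := abs_of_nonneg (by linarith)
  have h3 : |y + B| ≤ |y| + B := by
    rw [abs_of_nonpos hy, abs_le]; constructor <;> linarith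
  have h4 : |z + C| ≤ |z| + C := by
    rw [abs_of_nonpos hz, abs_le]; constructor <;> linarith
  have k3 := mul_le_mul_of_nonneg_right h3 hq.le
  have k4 := mul_le_mul_of_nonneg_right h4 hr.le
  rw [h1, h2]
  rcases lt_or_eq_of_le hy with hy' | rfl
  · have h5 : |y + B| < |y| + B := by
      rw [abs_of_nonpos hy, abs_lt]; constructor <;> linarith
    have k5 := mul_lt_mul_of_pos_right h5 hq
    linarith
  · rcases lt_or_eq_of_le hz with hz' | rfl
    · have h5 : |z + C| < |z| + C := by
        rw [abs_of_nonpos hz, abs_lt]; constructor <;> linarith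
      have k5 := mul_lt_mul_of_pos_right h5 hr
      linarith
    · exfalso
      have : 0 < x * p := mul_pos (by linarith) hp
      linarith

/-- The three minimal relations generate all the integer relations. -/
lemma h1_gen (ℓ m n a₁ a₂ b₁ b₂ c₁ c₂ : ℕ)
    (h : HerzogH1 ℓ m n a₁ a₂ b₁ b₂ c₁ c₂) (N : ℕ) : ∀ x y z : ℤ,
    x * ℓ + y * m + z * n = 0 → |x| * ℓ + |y| * m + |z| * n < N →
    ∃ s t : ℤ, x = - s * a₂ - t * a₁ ∧ y = s * (b₁ + b₂) - t * b₂ ∧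
      z = - s * c₁ + t * (c₁ + c₂) := by
  obtain ⟨hl, hm, hn, hg, ha1, ha2, hb1, hb2, hc1, hc2, e1, e2, e3, i1, i2, i3⟩ := h
  zify at hl hm hn ha1 ha2 hb1 hb2 hc1 hc2 e1 e2 e3
  induction N with
  | zero =>
    intro x y z _ hlt
    exfalso
    have : (0:ℤ) ≤ |x| * ℓ + |y| * m + |z| * n := by positivity
    push_cast at hlt
    linarith
  | succ N ih =>
    have A : ∀ x y z : ℤ, x * ℓ + y * m + z * n = 0 → |x| * ℓ + |y| * m + |z| * n < (N + 1 : ℕ) →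
        0 < x → y ≤ 0 → z ≤ 0 → ∃ s t : ℤ, x = - s * a₂ - t * a₁ ∧ y = s * (b₁ + b₂) - t * b₂ ∧
        z = - s * c₁ + t * (c₁ + c₂) := by
      intro x y z e hlt hx hy hz
      have hmin := h1_min i1 x y z hx hy hz e
      push_cast at hmin hlt
      have hd := h1_dec hl hm hn e1 hb1 hc2 (by linarith) hmin hy hz e
      obtain ⟨s, t, q1, q2, q3⟩ := ih (x - (a₁ + a₂)) (y + b₁) (z + c₂)
        (by linear_combination e - e1) (by linarith)
      exact ⟨s - 1, t - 1, by linear_combination q1, by linear_combination q2,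
        by linear_combination q3⟩
    have B : ∀ x y z : ℤ, x * ℓ + y * m + z * n = 0 → |x| * ℓ + |y| * m + |z| * n < (N + 1 : ℕ) →
        x ≤ 0 → 0 < y → z ≤ 0 → ∃ s t : ℤ, x = - s * a₂ - t * a₁ ∧ y = s * (b₁ + b₂) - t * b₂ ∧
        z = - s * c₁ + t * (c₁ + c₂) := by
      intro x y z e hlt hx hy hz
      have e' : y * m + x * ℓ + z * n = 0 := by linarith
      have hmin := h1_min i2 y x z hy hx hz e'
      push_cast at hmin hlt
      have hd := h1_dec hm hl hn e2 ha2 hc1 (by linarith) hmin hx hz e'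
      obtain ⟨s, t, q1, q2, q3⟩ := ih (x + a₂) (y - (b₁ + b₂)) (z + c₁)
        (by linear_combination e - e2) (by linarith)
      exact ⟨s + 1, t, by linear_combination q1, by linear_combination q2,
        by linear_combination q3⟩
    have C : ∀ x y z : ℤ, x * ℓ + y * m + z * n = 0 → |x| * ℓ + |y| * m + |z| * n < (N + 1 : ℕ) →
        x ≤ 0 → y ≤ 0 → 0 < z → ∃ s t : ℤ, x = - s * a₂ - t * a₁ ∧ y = s * (b₁ + b₂) - t * b₂ ∧
        z = - s * c₁ + t * (c₁ + c₂) := by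
      intro x y z e hlt hx hy hz
      have e' : z * n + x * ℓ + y * m = 0 := by linarith
      have hmin := h1_min i3 z x y hz hx hy e'
      push_cast at hmin hlt
      have hd := h1_dec hn hl hm e3 ha1 hb2 (by linarith) hmin hx hy e'
      obtain ⟨s, t, q1, q2, q3⟩ := ih (x + a₁) (y + b₂) (z - (c₁ + c₂))
        (by linear_combination e - e3) (by linarith)
      exact ⟨s, t + 1, by linear_combination q1, by linear_combination q2,
        by linear_combination q3⟩
    -- relations with a nonnegative pair of entries reduce to a negated relation
    intro x y z e hlt
    have en : (-x) * ℓ + (-y) * m + (-z) * n = 0 := by linear_combination -e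
    have hltn : |(-x)| * ℓ + |(-y)| * m + |(-z)| * n < ((N + 1 : ℕ) : ℤ) := by
      simpa only [abs_neg] using hlt
    have neg : (∃ s t : ℤ, -x = - s * a₂ - t * a₁ ∧ -y = s * (b₁ + b₂) - t * b₂ ∧
        -z = - s * c₁ + t * (c₁ + c₂)) → ∃ s t : ℤ, x = - s * a₂ - t * a₁ ∧
        y = s * (b₁ + b₂) - t * b₂ ∧ z = - s * c₁ + t * (c₁ + c₂) := by
      rintro ⟨s, t, q1, q2, q3⟩
      exact ⟨-s, -t, by linear_combination -q1, by linear_combination -q2,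
        by linear_combination -q3⟩
    have Z : ∀ x y z : ℤ, x * ℓ + y * m + z * n = 0 → 0 ≤ x → 0 ≤ y → 0 ≤ z →
        x = 0 ∧ y = 0 ∧ z = 0 := by
      intro x y z e hx hy hz
      have k1 := mul_nonneg hx hl.le
      have k2 := mul_nonneg hy hm.le
      have k3 := mul_nonneg hz hn.le
      refine ⟨?_, ?_, ?_⟩
      · exact (mul_eq_zero.1 (by linarith : x * ℓ = 0)).resolve_right hl.ne'
      · exact (mul_eq_zero.1 (by linarith : y * m = 0)).resolve_right hm.ne'
      · exact (mul_eq_zero.1 (by linarith : z * n = 0)).resolve_right hn.ne'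
    have Z1 := Z x y z e
    have Z2 := Z _ _ _ en
    by_cases h0 : x = 0 ∧ y = 0 ∧ z = 0
    · obtain ⟨rfl, rfl, rfl⟩ := h0
      exact ⟨0, 0, by simp, by simp, by simp⟩
    have hcases : (0 < x ∧ y ≤ 0 ∧ z ≤ 0) ∨ (x ≤ 0 ∧ 0 < y ∧ z ≤ 0) ∨ (x ≤ 0 ∧ y ≤ 0 ∧ 0 < z) ∨
        (0 < -x ∧ -y ≤ 0 ∧ -z ≤ 0) ∨ (-x ≤ 0 ∧ 0 < -y ∧ -z ≤ 0) ∨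
        (-x ≤ 0 ∧ -y ≤ 0 ∧ 0 < -z) := by
      clear A B C Z neg ih e en hlt hltn e1 e2 e3
      omega
    rcases hcases with ⟨hx, hy, hz⟩ | ⟨hx, hy, hz⟩ | ⟨hx, hy, hz⟩ | ⟨hx, hy, hz⟩ | ⟨hx, hy, hz⟩ |
      ⟨hx, hy, hz⟩
    · exact A x y z e hlt hx hy hz
    · exact B x y z e hlt hx hy hz
    · exact C x y z e hlt hx hy hz
    · exact neg (A _ _ _ en hltn hx hy hz)
    · exact neg (B _ _ _ en hltn hx hy hz)
    · exact neg (C _ _ _ en hltn hx hy hz)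

/-- Lemma 6(a): in Herzog's case (H1), the original generators are recovered as the
submaximal minors of the matrix of minimal relations. -/
theorem lemma6a (ℓ m n a₁ a₂ b₁ b₂ c₁ c₂ : ℕ)
    (h : HerzogH1 ℓ m n a₁ a₂ b₁ b₂ c₁ c₂) :
    ℓ = b₁ * c₁ + b₁ * c₂ + b₂ * c₂ ∧
    m = a₁ * c₁ + a₂ * c₁ + a₂ * c₂ ∧
    n = a₁ * b₁ + a₁ * b₂ + a₂ * b₂ := by
  have gen : ∀ x y z : ℤ, x * ℓ + y * m + z * n = 0 →
      ∃ s t : ℤ, x = - s * a₂ - t * a₁ ∧ y = s * (b₁ + b₂) - t * b₂ ∧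
      z = - s * c₁ + t * (c₁ + c₂) := by
    intro x y z e
    refine h1_gen ℓ m n a₁ a₂ b₁ b₂ c₁ c₂ h
      ((|x| * ℓ + |y| * m + |z| * n).toNat + 1) x y z e ?_
    have := Int.self_le_toNat (|x| * ℓ + |y| * m + |z| * n)
    push_cast at this ⊢
    linarith
  obtain ⟨hl, hm, hn, hg, ha1, ha2, hb1, hb2, hc1, hc2, e1, e2, e3, -, -, -⟩ := h
  have bez : ∃ u v w : ℤ, u * ℓ + v * m + w * n = 1 := by
    have g1 := Nat.gcd_eq_gcd_ab ℓ m
    have g2 := Nat.gcd_eq_gcd_ab (Nat.gcd ℓ m) n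
    rw [hg, g1] at g2
    refine ⟨Nat.gcdA ℓ m * Nat.gcdA (Nat.gcd ℓ m) n, Nat.gcdB ℓ m * Nat.gcdA (Nat.gcd ℓ m) n,
      Nat.gcdB (Nat.gcd ℓ m) n, ?_⟩
    push_cast at g2
    linear_combination -g2
  obtain ⟨u, v, w, hb⟩ := bez
  zify at hl hm hn ha1 ha2 hb1 hb2 hc1 hc2 e1 e2 e3 ⊢
  obtain ⟨L, hL⟩ : ∃ L : ℤ, L = b₁ * c₁ + b₁ * c₂ + b₂ * c₂ := ⟨_, rfl⟩
  obtain ⟨M, hM⟩ : ∃ M : ℤ, M = a₁ * c₁ + a₂ * c₁ + a₂ * c₂ := ⟨_, rfl⟩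
  obtain ⟨N, hN⟩ : ∃ N : ℤ, N = a₁ * b₁ + a₁ * b₂ + a₂ * b₂ := ⟨_, rfl⟩
  have LM : L * m = M * ℓ := by
    rw [hL, hM]; linear_combination (c₁ + c₂ : ℤ) * e2 + (c₁ : ℤ) * e3
  have LN : L * n = N * ℓ := by
    rw [hL, hN]; linear_combination (b₂ : ℤ) * e2 + (b₁ + b₂ : ℤ) * e3
  have MN : M * n = N * m := by
    rw [hM, hN]; linear_combination (a₂ : ℤ) * e3 - (a₁ : ℤ) * e2
  obtain ⟨k, hk⟩ : ∃ k : ℤ, k = u * L + v * M + w * N := ⟨_, rfl⟩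
  have kL : L = k * ℓ := by rw [hk]; linear_combination v * LM + w * LN - L * hb
  have kM : M = k * m := by rw [hk]; linear_combination -u * LM + w * MN - M * hb
  have kN : N = k * n := by rw [hk]; linear_combination -u * LN - v * MN - N * hb
  obtain ⟨s, t, p1, p2, p3⟩ := gen m (-ℓ) 0 (by ring)
  obtain ⟨s₂, t₂, q1, q2, q3⟩ := gen n 0 (-ℓ) (by ring)
  obtain ⟨s₃, t₃, r1, r2, r3⟩ := gen 0 n (-m) (by ring)
  have hLpos : 0 < L := by rw [hL]; positivity
  have dL : (ℓ : ℤ) * ℓ = (s * t₂ - t * s₂) * L := by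
    rw [hL]
    linear_combination (-ℓ : ℤ) * q3 + (- s₂ * c₁ + t₂ * (c₁ + c₂)) * p2
      - (s₂ * (b₁ + b₂) - t₂ * b₂) * p3
  have dM : (m : ℤ) * m = (s * t₃ - t * s₃) * M := by
    rw [hM]
    linear_combination (m : ℤ) * p1
      - (- s * a₂ - t * a₁) * r3 + (- s₃ * a₂ - t₃ * a₁) * p3
  have dN : (n : ℤ) * n = (s₂ * t₃ - t₂ * s₃) * N := by
    rw [hN]
    linear_combination (n : ℤ) * r2 + (s₃ * (b₁ + b₂) - t₃ * b₂) * q1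
      - (- s₃ * a₂ - t₃ * a₁) * q2
  have fL : (ℓ : ℤ) = (s * t₂ - t * s₂) * k := by
    apply mul_right_cancel₀ hl.ne'
    rw [dL, kL]; ring
  have fM : (m : ℤ) = (s * t₃ - t * s₃) * k := by
    apply mul_right_cancel₀ hm.ne'
    rw [dM, kM]; ring
  have fN : (n : ℤ) = (s₂ * t₃ - t₂ * s₃) * k := by
    apply mul_right_cancel₀ hn.ne'
    rw [dN, kN]; ring
  have kdvd : k ∣ 1 := by
    rw [← hb]
    exact dvd_add (dvd_add (Dvd.dvd.mul_left ⟨_, fL.trans (mul_comm _ _)⟩ _)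
      (Dvd.dvd.mul_left ⟨_, fM.trans (mul_comm _ _)⟩ _))
      (Dvd.dvd.mul_left ⟨_, fN.trans (mul_comm _ _)⟩ _)
  have kpos : 0 < k := by
    rw [kL] at hLpos
    exact pos_of_mul_pos_left hLpos hl.le
  have k1 : k = 1 := Int.eq_one_of_dvd_one kpos.le kdvd
  subst k1
  exact ⟨by linarith, by linarith, by linarith⟩
end

section
/- Let ℓ, m, n be positive integers with gcd(ℓ,m,n) = 1 and set d = gcd(ℓ,m). Suppose a is the least positive integer with a·ℓ ∈ ⟨m,n⟩ and that a·ℓ = b·m for a positive integer b; suppose c is the least positive integer with c·n ∈ ⟨ℓ,m⟩ and c·n = a₁·ℓ + b₂·m with a₁, b₂ ∈ ℕ. Then ℓ = b·d, m = a·d, c·n = (a₁·b + a·b₂)·d, and gcd(n,d) = 1. (Lemma 6(b)) -/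
/-- Lemma 6(b): in Herzog's case (H2) (with minimal relation `a·ℓ = b·m`), the original
generators `ℓ, m, n` and `d = gcd(ℓ,m)` are recovered from the relation data. -/
theorem lemma6b (ℓ m n a b c a₁ b₂ : ℕ)
    (hℓ : 0 < ℓ) (hm : 0 < m) (hn : 0 < n)
    (hgcd : Nat.gcd (Nat.gcd ℓ m) n = 1)
    (hb : 0 < b)
    (hamin : IsLeast {k | 0 < k ∧ k * ℓ ∈ AddSubmonoid.closure ({m, n} : Set ℕ)} a)
    (hab : a * ℓ = b * m)
    (hcmin : IsLeast {k | 0 < k ∧ k * n ∈ AddSubmonoid.closure ({ℓ, m} : Set ℕ)} c)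
    (hcn : c * n = a₁ * ℓ + b₂ * m) :
    ℓ = b * Nat.gcd ℓ m ∧ m = a * Nat.gcd ℓ m ∧
    c * n = (a₁ * b + a * b₂) * Nat.gcd ℓ m ∧
    Nat.gcd n (Nat.gcd ℓ m) = 1 := by
  obtain ⟨d, lq, mq, hd, hco, h1, h2⟩ := Nat.exists_coprime' (Nat.gcd_pos_of_pos_left m hℓ)
  have hg : Nat.gcd ℓ m = d := by
    rw [h1, h2, Nat.gcd_mul_right, hco.gcd_eq_one, one_mul]
  have hmq : 0 < mq := by
    rcases Nat.eq_zero_or_pos mq with h | h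
    · simp [h] at h2; omega
    · exact h
  have hle : a ≤ mq := by
    apply hamin.2
    refine ⟨hmq, ?_⟩
    have : mq * ℓ = lq • m := by rw [h1, h2, smul_eq_mul]; ring
    rw [this]
    exact AddSubmonoid.nsmul_mem _ (AddSubmonoid.subset_closure (by simp)) _
  have hapos : 0 < a := hamin.1.1
  have h3 : a * lq = b * mq := by
    apply Nat.eq_of_mul_eq_mul_right hd
    calc a * lq * d = a * ℓ := by rw [h1]; ring
      _ = b * m := hab
      _ = b * mq * d := by rw [h2]; ring
  have hdvd : mq ∣ a := hco.symm.dvd_of_dvd_mul_right ⟨b, by rw [h3]; ring⟩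
  have ha : a = mq := le_antisymm hle (Nat.le_of_dvd hapos hdvd)
  have hbl : b = lq := by
    apply Nat.eq_of_mul_eq_mul_right hmq
    rw [← h3, ha]; ring
  rw [hg] at hgcd ⊢
  refine ⟨by rw [hbl]; exact h1, by rw [ha]; exact h2, ?_, by rw [Nat.gcd_comm]; exact hgcd⟩
  rw [hcn, h1, h2, ha, hbl]; ring
end

section
/- Let K be a field and let ℓ, m, n with gcd(ℓ,m,n) = 1 be in Herzog's case (H1) with data a₁,a₂,b₁,b₂,c₁,c₂, and let I = ker φ be the defining ideal of the monomial curve. Let ñ be the least positive integer such that x^ñ − z^j ∈ I for some j ∈ ℕ, and let ℓ̃ be such a j. Then gcd(ℓ̃, ñ) = 1, ñ·gcd(b₁,b₂) = n' and ℓ̃·gcd(b₁,b₂) = ℓ', where ℓ' = b₁c₁ + b₁c₂ + b₂c₂ and n' = a₁b₁ + a₁b₂ + a₂b₂. (Lemma 3) -/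
/-- The defining ideal of the monomial space curve `(x,y,z) = (t^ℓ, t^m, t^n)`. -/
noncomputable def monomialCurveIdeal (K : Type*) [Field K] (ℓ m n : ℕ) :
    Ideal (MvPolynomial (Fin 3) K) :=
  RingHom.ker ((MvPolynomial.aeval
    (fun i : Fin 3 => (Polynomial.X : Polynomial K) ^ (![ℓ, m, n] i)) :
      MvPolynomial (Fin 3) K →ₐ[K] Polynomial K) : MvPolynomial (Fin 3) K →+* Polynomial K)

theorem mem_curve_iff (K : Type*) [Field K] (ℓ m n k j : ℕ) :
    ((MvPolynomial.X 0 : MvPolynomial (Fin 3) K) ^ k - MvPolynomial.X 2 ^ j ∈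
        monomialCurveIdeal K ℓ m n) ↔ k * ℓ = j * n := by
  unfold monomialCurveIdeal
  rw [RingHom.mem_ker]
  simp only [RingHom.coe_coe, map_sub, map_pow, MvPolynomial.aeval_X]
  rw [sub_eq_zero]
  simp only [Matrix.cons_val, Matrix.cons_val_zero, ← pow_mul]
  constructor
  · intro h
    have := congrArg Polynomial.natDegree h
    simp only [Polynomial.natDegree_X_pow] at this
    linarith [mul_comm ℓ k, mul_comm n j]
  · intro h
    rw [mul_comm ℓ, mul_comm n, h]

theorem step_lt (p q r A B C u v w : ℤ) (hq : 0 < q) (hr : 0 < r) (hp : 0 < p)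
    (hB : 0 < B) (hC : 0 < C) (hA : 0 < A) (hAu : A ≤ u) (hv : v ≤ 0) (hw : w ≤ 0)
    (hrel : A * p = B * q + C * r) (h0 : u * p + v * q + w * r = 0) :
    |u - A| * p + |v + B| * q + |w + C| * r < |u| * p + |v| * q + |w| * r := by
  rw [abs_of_nonneg (show 0 ≤ u - A by linarith), abs_of_nonneg (show 0 ≤ u by linarith),
    abs_of_nonpos hv, abs_of_nonpos hw]
  have h1 : |v + B| ≤ B - v := abs_le.2 ⟨by linarith, by linarith⟩
  have h2 : |w + C| ≤ C - w := abs_le.2 ⟨by linarith, by linarith⟩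
  have h1' := mul_le_mul_of_nonneg_right h1 hq.le
  have h2' := mul_le_mul_of_nonneg_right h2 hr.le
  rcases hv.lt_or_eq with hv' | rfl
  · have h3 : |v + B| < B - v := abs_lt.2 ⟨by linarith, by linarith⟩
    have h3' := mul_lt_mul_of_pos_right h3 hq
    nlinarith
  · have hw' : w < 0 := by
      rcases hw.lt_or_eq with hw' | rfl
      · exact hw'
      · nlinarith
    have h3 : |w + C| < C - w := abs_lt.2 ⟨by linarith, by linarith⟩
    have h3' := mul_lt_mul_of_pos_right h3 hr
    nlinarith

theorem lattice_gen (p q r a₁ a₂ b₁ b₂ c₁ c₂ : ℤ) (hp : 0 < p) (hq : 0 < q) (hr : 0 < r)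
    (ha₁ : 0 < a₁) (ha₂ : 0 < a₂) (hb₁ : 0 < b₁) (hb₂ : 0 < b₂) (hc₁ : 0 < c₁) (hc₂ : 0 < c₂)
    (e1 : (a₁ + a₂) * p = b₁ * q + c₂ * r)
    (e2 : (b₁ + b₂) * q = a₂ * p + c₁ * r)
    (e3 : (c₁ + c₂) * r = a₁ * p + b₂ * q)
    (mA : ∀ u v w : ℤ, 0 < u → v ≤ 0 → w ≤ 0 → u * p + v * q + w * r = 0 → a₁ + a₂ ≤ u)
    (mB : ∀ u v w : ℤ, 0 < v → u ≤ 0 → w ≤ 0 → u * p + v * q + w * r = 0 → b₁ + b₂ ≤ v)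
    (mC : ∀ u v w : ℤ, 0 < w → u ≤ 0 → v ≤ 0 → u * p + v * q + w * r = 0 → c₁ + c₂ ≤ w)
    (N : ℕ) : ∀ u v w : ℤ, u * p + v * q + w * r = 0 → |u| * p + |v| * q + |w| * r < N →
      ∃ s t : ℤ, u = s * (a₁ + a₂) - t * a₁ ∧ v = -s * b₁ - t * b₂ ∧
        w = -s * c₂ + t * (c₁ + c₂) := by
  induction N with
  | zero =>
    intro u v w _ h
    have := mul_nonneg (abs_nonneg u) hp.le
    have := mul_nonneg (abs_nonneg v) hq.le
    have := mul_nonneg (abs_nonneg w) hr.le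
    push_cast at h
    linarith
  | succ N ih =>
    have key : ∀ u v w : ℤ, u * p + v * q + w * r = 0 →
        |u| * p + |v| * q + |w| * r < (N + 1 : ℕ) →
        ((0 < u ∧ v ≤ 0 ∧ w ≤ 0) ∨ (0 < v ∧ u ≤ 0 ∧ w ≤ 0) ∨ (0 < w ∧ u ≤ 0 ∧ v ≤ 0)) →
        ∃ s t : ℤ, u = s * (a₁ + a₂) - t * a₁ ∧ v = -s * b₁ - t * b₂ ∧
        w = -s * c₂ + t * (c₁ + c₂) := by
      intro u v w h0 hN hc
      push_cast at hN
      rcases hc with ⟨h1, h2, h3⟩ | ⟨h1, h2, h3⟩ | ⟨h1, h2, h3⟩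
      · have hm := mA u v w h1 h2 h3 h0
        have := step_lt p q r (a₁ + a₂) b₁ c₂ u v w hq hr hp hb₁ hc₂ (by linarith) hm h2 h3 e1 h0
        obtain ⟨s, t, hs, ht, hst⟩ := ih (u - (a₁ + a₂)) (v + b₁) (w + c₂) (by linarith) (by linarith)
        exact ⟨s + 1, t, by linarith, by linarith, by linarith⟩
      · have hm := mB u v w h1 h2 h3 h0
        have := step_lt q p r (b₁ + b₂) a₂ c₁ v u w hp hr hq ha₂ hc₁ (by linarith) hm h2 h3 e2
          (by linarith)
        obtain ⟨s, t, hs, ht, hst⟩ := ih (u + a₂) (v - (b₁ + b₂)) (w + c₁) (by linarith) (by linarith)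
        exact ⟨s - 1, t - 1, by linarith, by linarith, by linarith⟩
      · have hm := mC u v w h1 h2 h3 h0
        have := step_lt r p q (c₁ + c₂) a₁ b₂ w u v hp hq hr ha₁ hb₂ (by linarith) hm h2 h3 e3
          (by linarith)
        obtain ⟨s, t, hs, ht, hst⟩ := ih (u + a₁) (v + b₂) (w - (c₁ + c₂)) (by linarith) (by linarith)
        exact ⟨s, t + 1, by linarith, by linarith, by linarith⟩
    intro u v w h0 hN
    by_cases hc : (0 < u ∧ v ≤ 0 ∧ w ≤ 0) ∨ (0 < v ∧ u ≤ 0 ∧ w ≤ 0) ∨ (0 < w ∧ u ≤ 0 ∧ v ≤ 0)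
    · exact key u v w h0 hN hc
    by_cases hc' : (0 < -u ∧ -v ≤ 0 ∧ -w ≤ 0) ∨ (0 < -v ∧ -u ≤ 0 ∧ -w ≤ 0) ∨
        (0 < -w ∧ -u ≤ 0 ∧ -v ≤ 0)
    · obtain ⟨s, t, hs, ht, hst⟩ := key (-u) (-v) (-w) (by linarith)
        (by simpa only [abs_neg] using hN) hc'
      exact ⟨-s, -t, by linarith, by linarith, by linarith⟩
    · have hs : (0 ≤ u ∧ 0 ≤ v ∧ 0 ≤ w) ∨ (u ≤ 0 ∧ v ≤ 0 ∧ w ≤ 0) := by omega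
      have hz : u = 0 ∧ v = 0 ∧ w = 0 := by
        rcases hs with ⟨h1, h2, h3⟩ | ⟨h1, h2, h3⟩
        · refine ⟨?_, ?_, ?_⟩ <;> nlinarith [mul_nonneg h1 hp.le, mul_nonneg h2 hq.le,
            mul_nonneg h3 hr.le]
        · have h1' := mul_nonneg (neg_nonneg.2 h1) hp.le
          have h2' := mul_nonneg (neg_nonneg.2 h2) hq.le
          have h3' := mul_nonneg (neg_nonneg.2 h3) hr.le
          refine ⟨?_, ?_, ?_⟩ <;> nlinarith
      obtain ⟨rfl, rfl, rfl⟩ := hz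
      exact ⟨0, 0, by simp, by simp, by simp⟩

theorem eq_one_aux (x N k : ℤ) (hx : 0 < x) (hN : x ≤ N) (h : x = k * N) : k = 1 := by
  have h1 : 0 < k := by
    by_contra hk
    nlinarith
  have h2 : k < 2 := by
    by_contra hk
    nlinarith
  omega

theorem min_int (p q r A : ℕ)
    (h : IsLeast {k | 0 < k ∧ k * p ∈ AddSubmonoid.closure ({q, r} : Set ℕ)} A)
    (u v w : ℤ) (hu : 0 < u) (hv : v ≤ 0) (hw : w ≤ 0) (h0 : u * p + v * q + w * r = 0) :
    (A : ℤ) ≤ u := by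
  lift u to ℕ using hu.le
  obtain ⟨v', rfl⟩ : ∃ v' : ℕ, v = -(v' : ℤ) := ⟨v.natAbs, by omega⟩
  obtain ⟨w', rfl⟩ : ∃ w' : ℕ, w = -(w' : ℤ) := ⟨w.natAbs, by omega⟩
  have h1 : u * p = v' * q + w' * r := by
    zify
    linarith
  have : A ≤ u := by
    apply h.2
    refine ⟨by exact_mod_cast hu, ?_⟩
    rw [AddSubmonoid.mem_closure_pair]
    exact ⟨v', w', by simp [h1]⟩
  exact_mod_cast this

/-- Lemma 3: if `ntil` is minimal with `x^ntil − z^ltil ∈ I`, then `gcd(ltil, ntil) = 1` and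
`(ntil, ltil)·gcd(b₁,b₂) = (n', ℓ')`. -/
theorem lemma3 (K : Type*) [Field K] (ℓ m n a₁ a₂ b₁ b₂ c₁ c₂ : ℕ)
    (h : HerzogH1 ℓ m n a₁ a₂ b₁ b₂ c₁ c₂) (ntil ltil : ℕ)
    (hmin : IsLeast {k | 0 < k ∧ ∃ j : ℕ,
      (MvPolynomial.X 0 : MvPolynomial (Fin 3) K) ^ k - MvPolynomial.X 2 ^ j ∈
        monomialCurveIdeal K ℓ m n} ntil)
    (hltil : (MvPolynomial.X 0 : MvPolynomial (Fin 3) K) ^ ntil - MvPolynomial.X 2 ^ ltil ∈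
      monomialCurveIdeal K ℓ m n) :
    Nat.gcd ltil ntil = 1 ∧
    ntil * Nat.gcd b₁ b₂ = a₁ * b₁ + a₁ * b₂ + a₂ * b₂ ∧
    ltil * Nat.gcd b₁ b₂ = b₁ * c₁ + b₁ * c₂ + b₂ * c₂ := by
  simp only [mem_curve_iff] at hmin hltil
  obtain ⟨hl, hm, hn, -, ha₁, ha₂, hb₁, hb₂, hc₁, hc₂, e1, e2, e3, mA, mB, mC⟩ := h
  have hpos : 0 < ntil := hmin.1.1
  have hle : ∀ k j : ℕ, 0 < k → k * ℓ = j * n → ntil ≤ k := fun k j h1 h2 => hmin.2 ⟨h1, j, h2⟩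
  refine ⟨?_, ?_⟩
  · obtain ⟨q, hq⟩ := Nat.gcd_dvd_left ltil ntil
    obtain ⟨p, hp⟩ := Nat.gcd_dvd_right ltil ntil
    have he : 0 < Nat.gcd ltil ntil := Nat.gcd_pos_of_pos_right _ hpos
    generalize Nat.gcd ltil ntil = e at *
    have hp0 : 0 < p := by
      rcases Nat.eq_zero_or_pos p with rfl | h
      · simp at hp; omega
      · exact h
    have := hle p q hp0 (by
      apply Nat.eq_of_mul_eq_mul_left he
      rw [← mul_assoc, ← mul_assoc, ← hp, ← hq, hltil])
    nlinarith
  · have hg : 0 < Nat.gcd b₁ b₂ := Nat.gcd_pos_of_pos_left _ hb₁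
    obtain ⟨β₁, β₂, hcop, hβ₁, hβ₂⟩ : ∃ β₁ β₂ : ℕ, Nat.Coprime β₁ β₂ ∧
        b₁ = β₁ * Nat.gcd b₁ b₂ ∧ b₂ = β₂ * Nat.gcd b₁ b₂ :=
      Nat.exists_coprime b₁ b₂
    generalize Nat.gcd b₁ b₂ = g at *
    have hβ₂0 : 0 < β₂ := by
      rcases Nat.eq_zero_or_pos β₂ with rfl | h
      · simp at hβ₂; omega
      · exact h
    have hzl : (ntil : ℤ) * ℓ + 0 * m + (-ltil) * n = 0 := by
      have : (ntil : ℤ) * ℓ = ltil * n := by exact_mod_cast hltil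
      linarith
    have e1' : ((a₁ : ℤ) + a₂) * ℓ = b₁ * m + c₂ * n := by exact_mod_cast e1
    have e2' : ((b₁ : ℤ) + b₂) * m = a₂ * ℓ + c₁ * n := by exact_mod_cast e2
    have e3' : ((c₁ : ℤ) + c₂) * n = a₁ * ℓ + b₂ * m := by exact_mod_cast e3
    obtain ⟨s, t, hs, ht, hst⟩ := lattice_gen ℓ m n a₁ a₂ b₁ b₂ c₁ c₂
      (by exact_mod_cast hl) (by exact_mod_cast hm) (by exact_mod_cast hn)
      (by exact_mod_cast ha₁) (by exact_mod_cast ha₂) (by exact_mod_cast hb₁)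
      (by exact_mod_cast hb₂) (by exact_mod_cast hc₁) (by exact_mod_cast hc₂) e1' e2' e3'
      (fun u v w h1 h2 h3 h0 => by
        have := min_int _ _ _ _ mA u v w h1 h2 h3 h0
        exact_mod_cast this)
      (fun u v w h1 h2 h3 h0 => by
        have := min_int _ _ _ _ mB v u w h1 h2 h3 (by linarith)
        exact_mod_cast this)
      (fun u v w h1 h2 h3 h0 => by
        have := min_int _ _ _ _ mC w u v h1 h2 h3 (by linarith)
        exact_mod_cast this)
      (ntil * ℓ + ltil * n + 1) ntil 0 (-ltil) hzl (by simp)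
    have hβ₁z : (b₁ : ℤ) = β₁ * g := by exact_mod_cast hβ₁
    have hβ₂z : (b₂ : ℤ) = β₂ * g := by exact_mod_cast hβ₂
    have hgz : (g : ℤ) ≠ 0 := by exact_mod_cast hg.ne'
    have hβ₂z0 : (β₂ : ℤ) ≠ 0 := by exact_mod_cast hβ₂0.ne'
    have hrel : s * β₁ = -t * β₂ := by
      apply mul_right_cancel₀ hgz
      rw [hβ₁z, hβ₂z] at ht
      linarith
    have hdvd : (β₂ : ℤ) ∣ s := by
      have hc : IsCoprime (β₂ : ℤ) (β₁ : ℤ) := Nat.isCoprime_iff_coprime.2 hcop.symm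
      exact hc.dvd_of_dvd_mul_right ⟨-t, by rw [hrel]; ring⟩
    obtain ⟨k, rfl⟩ := hdvd
    have htk : t = -k * β₁ := by
      apply mul_right_cancel₀ hβ₂z0
      linarith
    subst htk
    have hN : ntil ≤ β₂ * (a₁ + a₂) + β₁ * a₁ := by
      apply hle _ (β₂ * c₂ + β₁ * (c₁ + c₂)) (by positivity)
      zify
      rw [hβ₁z] at e1'
      rw [hβ₂z] at e3'
      linear_combination (β₂ : ℤ) * e1' - β₁ * e3'
    have hs' : (ntil : ℤ) = k * ((β₂ * (a₁ + a₂) + β₁ * a₁ : ℕ) : ℤ) := by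
      push_cast
      linarith
    have hNz : (ntil : ℤ) ≤ ((β₂ * (a₁ + a₂) + β₁ * a₁ : ℕ) : ℤ) := by exact_mod_cast hN
    have hpz : (0 : ℤ) < ntil := by exact_mod_cast hpos
    have hNp : (0 : ℤ) < ((β₂ * (a₁ + a₂) + β₁ * a₁ : ℕ) : ℤ) := by linarith
    have hk : k = 1 := eq_one_aux _ _ _ hpz hNz hs'
    subst hk
    constructor
    · zify
      rw [hs', hβ₁z, hβ₂z]
      push_cast
      ring
    · zify
      have : (ltil : ℤ) = β₂ * c₂ + β₁ * (c₁ + c₂) := by linarith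
      rw [this, hβ₁z, hβ₂z]
      ring
end

section
/- Let a₁,a₂,b₁,b₂,c₁,c₂ be positive integers; set a = a₁+a₂, b = b₁+b₂, c = c₁+c₂, ℓ' = b₁c₁ + b₁c₂ + b₂c₂, m' = a₁c₁ + a₂c₁ + a₂c₂, n' = a₁b₁ + a₁b₂ + a₂b₂, and e' = gcd(ℓ',m',n'). Then there exist positive integers ℓ, m, n with gcd(ℓ,m,n) = 1 such that (ℓ,m,n) is in Herzog's case (H1) with data exactly a₁,a₂,b₁,b₂,c₁,c₂ if and only if e' = 1; moreover, in this case necessarily (ℓ,m,n) = (ℓ',m',n'). (Proposition 7(a)) -/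
/-- One reduction step: subtracting a relation decreases the weight. -/
lemma step_weight (ℓ m n a b₁ c₂ x y z : ℤ) (hℓ : 0 < ℓ) (hm : 0 < m) (hn : 0 < n)
    (hb : 0 < b₁) (hc : 0 < c₂) (hrel : a * ℓ = b₁ * m + c₂ * n)
    (hmin : ∀ k y z : ℤ, 0 < k → 0 ≤ y → 0 ≤ z → k * ℓ = y * m + z * n → a ≤ k)
    (hx : 0 < x) (hy : y ≤ 0) (hz : z ≤ 0) (h : x * ℓ + y * m + z * n = 0) :
    |x - a| * ℓ + |y + b₁| * m + |z + c₂| * n < |x| * ℓ + |y| * m + |z| * n := by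
  have hax : a ≤ x := hmin x (-y) (-z) hx (by omega) (by omega) (by linarith)
  have e1 : |x - a| = |x| - a := by rw [abs_of_nonneg (by omega), abs_of_pos hx]
  have e2 : |y + b₁| ≤ |y| + b₁ := by
    rw [abs_of_nonpos hy, abs_le]; constructor <;> omega
  have e3 : |z + c₂| ≤ |z| + c₂ := by
    rw [abs_of_nonpos hz, abs_le]; constructor <;> omega
  have h2 := mul_le_mul_of_nonneg_right e2 hm.le
  have h3 := mul_le_mul_of_nonneg_right e3 hn.le
  rw [e1]
  rcases hy.lt_or_eq with hy' | hy'
  · have e2' : |y + b₁| < |y| + b₁ := by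
      rw [abs_of_nonpos hy, abs_lt]; constructor <;> omega
    have h2' := mul_lt_mul_of_pos_right e2' hm
    linarith
  · rcases hz.lt_or_eq with hz' | hz'
    · have e3' : |z + c₂| < |z| + c₂ := by
        rw [abs_of_nonpos hz, abs_lt]; constructor <;> omega
      have h3' := mul_lt_mul_of_pos_right e3' hn
      linarith
    · subst hy' hz'
      have := mul_pos hx hℓ
      linarith

/-- The three Herzog relations generate the relation lattice. -/
lemma lattice_gen_s3 (ℓ m n a₁ a₂ b₁ b₂ c₁ c₂ : ℤ) (hℓ : 0 < ℓ) (hm : 0 < m) (hn : 0 < n)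
    (ha₁ : 0 < a₁) (ha₂ : 0 < a₂) (hb₁ : 0 < b₁) (hb₂ : 0 < b₂) (hc₁ : 0 < c₁) (hc₂ : 0 < c₂)
    (r1 : (a₁ + a₂) * ℓ = b₁ * m + c₂ * n)
    (r2 : (b₁ + b₂) * m = a₂ * ℓ + c₁ * n)
    (r3 : (c₁ + c₂) * n = a₁ * ℓ + b₂ * m)
    (m1 : ∀ k y z : ℤ, 0 < k → 0 ≤ y → 0 ≤ z → k * ℓ = y * m + z * n → a₁ + a₂ ≤ k)
    (m2 : ∀ k y z : ℤ, 0 < k → 0 ≤ y → 0 ≤ z → k * m = y * ℓ + z * n → b₁ + b₂ ≤ k)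
    (m3 : ∀ k y z : ℤ, 0 < k → 0 ≤ y → 0 ≤ z → k * n = y * ℓ + z * m → c₁ + c₂ ≤ k) :
    ∀ (N : ℕ) (x y z : ℤ), x * ℓ + y * m + z * n = 0 →
      |x| * ℓ + |y| * m + |z| * n < N →
      ∃ p q : ℤ, x = p * (a₁ + a₂) - q * a₂ ∧ y = -p * b₁ + q * (b₁ + b₂) ∧
        z = -p * c₂ - q * c₁ := by
  intro N
  induction N with
  | zero =>
    intro x y z _ hw
    have := mul_nonneg (abs_nonneg x) hℓ.le
    have := mul_nonneg (abs_nonneg y) hm.le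
    have := mul_nonneg (abs_nonneg z) hn.le
    push_cast at hw
    linarith
  | succ N ih =>
    -- the three positive patterns
    have P1 : ∀ x y z : ℤ, x * ℓ + y * m + z * n = 0 →
        |x| * ℓ + |y| * m + |z| * n < (N + 1 : ℕ) → 0 < x → y ≤ 0 → z ≤ 0 →
        ∃ p q : ℤ, x = p * (a₁ + a₂) - q * a₂ ∧ y = -p * b₁ + q * (b₁ + b₂) ∧
        z = -p * c₂ - q * c₁ := by
      intro x y z h hw hx hy hz
      have hs := step_weight ℓ m n (a₁ + a₂) b₁ c₂ x y z hℓ hm hn hb₁ hc₂ r1 m1 hx hy hz h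
      obtain ⟨p, q, h1, h2, h3⟩ := ih (x - (a₁ + a₂)) (y + b₁) (z + c₂) (by linarith)
        (by push_cast at hw; linarith)
      exact ⟨p + 1, q, by linarith, by linarith, by linarith⟩
    have P2 : ∀ x y z : ℤ, x * ℓ + y * m + z * n = 0 →
        |x| * ℓ + |y| * m + |z| * n < (N + 1 : ℕ) → 0 < y → x ≤ 0 → z ≤ 0 →
        ∃ p q : ℤ, x = p * (a₁ + a₂) - q * a₂ ∧ y = -p * b₁ + q * (b₁ + b₂) ∧
        z = -p * c₂ - q * c₁ := by
      intro x y z h hw hy hx hz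
      have hs := step_weight m ℓ n (b₁ + b₂) a₂ c₁ y x z hm hℓ hn ha₂ hc₁ r2 m2 hy hx hz
        (by linarith)
      obtain ⟨p, q, h1, h2, h3⟩ := ih (x + a₂) (y - (b₁ + b₂)) (z + c₁) (by linarith)
        (by push_cast at hw; linarith)
      exact ⟨p, q + 1, by linarith, by linarith, by linarith⟩
    have P3 : ∀ x y z : ℤ, x * ℓ + y * m + z * n = 0 →
        |x| * ℓ + |y| * m + |z| * n < (N + 1 : ℕ) → 0 < z → x ≤ 0 → y ≤ 0 →
        ∃ p q : ℤ, x = p * (a₁ + a₂) - q * a₂ ∧ y = -p * b₁ + q * (b₁ + b₂) ∧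
        z = -p * c₂ - q * c₁ := by
      intro x y z h hw hz hx hy
      have hs := step_weight n ℓ m (c₁ + c₂) a₁ b₂ z x y hn hℓ hm ha₁ hb₂ r3 m3 hz hx hy
        (by linarith)
      obtain ⟨p, q, h1, h2, h3⟩ := ih (x + a₁) (y + b₂) (z - (c₁ + c₂)) (by linarith)
        (by push_cast at hw; linarith)
      exact ⟨p - 1, q - 1, by linarith, by linarith, by linarith⟩
    intro x y z h hw
    have hneg : (∃ p q : ℤ, -x = p * (a₁ + a₂) - q * a₂ ∧ -y = -p * b₁ + q * (b₁ + b₂) ∧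
        -z = -p * c₂ - q * c₁) → ∃ p q : ℤ, x = p * (a₁ + a₂) - q * a₂ ∧
        y = -p * b₁ + q * (b₁ + b₂) ∧ z = -p * c₂ - q * c₁ := by
      rintro ⟨p, q, h1, h2, h3⟩
      exact ⟨-p, -q, by linarith, by linarith, by linarith⟩
    have h' : -x * ℓ + -y * m + -z * n = 0 := by linarith
    have hw' : |-x| * ℓ + |-y| * m + |-z| * n < (N + 1 : ℕ) := by simpa only [abs_neg] using hw
    rcases lt_or_ge 0 x with hx | hx <;> rcases lt_or_ge 0 y with hy | hy <;>
      rcases lt_or_ge 0 z with hz | hz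
    · have := mul_pos hx hℓ
      have := mul_pos hy hm
      have := mul_pos hz hn
      linarith
    · rcases hz.lt_or_eq with hz' | hz'
      · exact hneg (P3 _ _ _ h' hw' (by omega) (by omega) (by omega))
      · subst hz'
        have := mul_pos hx hℓ
        have := mul_pos hy hm
        linarith
    · rcases hy.lt_or_eq with hy' | hy'
      · exact hneg (P2 _ _ _ h' hw' (by omega) (by omega) (by omega))
      · subst hy'
        have := mul_pos hx hℓ
        have := mul_pos hz hn
        linarith
    · exact P1 _ _ _ h hw hx hy hz
    · rcases hx.lt_or_eq with hx' | hx'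
      · exact hneg (P1 _ _ _ h' hw' (by omega) (by omega) (by omega))
      · subst hx'
        have := mul_pos hy hm
        have := mul_pos hz hn
        linarith
    · exact P2 _ _ _ h hw hy hx hz
    · exact P3 _ _ _ h hw hz hx hy
    · have t1 := mul_nonpos_of_nonpos_of_nonneg hx hℓ.le
      have t2 := mul_nonpos_of_nonpos_of_nonneg hy hm.le
      have t3 := mul_nonpos_of_nonpos_of_nonneg hz hn.le
      have x0 : x = 0 := (mul_eq_zero.mp (by linarith : x * ℓ = 0)).resolve_right hℓ.ne'
      have y0 : y = 0 := (mul_eq_zero.mp (by linarith : y * m = 0)).resolve_right hm.ne'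
      have z0 : z = 0 := (mul_eq_zero.mp (by linarith : z * n = 0)).resolve_right hn.ne'
      exact ⟨0, 0, by simp [x0], by simp [y0], by simp [z0]⟩

lemma min_int_s3 (ℓ m n a : ℕ)
    (h : IsLeast {k | 0 < k ∧ k * ℓ ∈ AddSubmonoid.closure ({m, n} : Set ℕ)} a) :
    ∀ k y z : ℤ, 0 < k → 0 ≤ y → 0 ≤ z → k * ℓ = y * m + z * n → (a : ℤ) ≤ k := by
  intro k y z hk hy hz he
  lift k to ℕ using hk.le
  lift y to ℕ using hy
  lift z to ℕ using hz
  have : a ≤ k := h.2 ⟨by exact_mod_cast hk, by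
    rw [AddSubmonoid.mem_closure_pair]
    exact ⟨y, z, by simp only [smul_eq_mul]; exact_mod_cast he.symm⟩⟩
  exact_mod_cast this

lemma min_nat (ℓ m n a₁ a₂ b₁ b₂ c₁ c₂ : ℕ)
    (ha₁ : 0 < a₁) (ha₂ : 0 < a₂) (hb₁ : 0 < b₁) (hb₂ : 0 < b₂) (hc₁ : 0 < c₁) (hc₂ : 0 < c₂)
    (hl : ℓ = b₁ * c₁ + b₁ * c₂ + b₂ * c₂) (hm : m = a₁ * c₁ + a₂ * c₁ + a₂ * c₂)
    (hn : n = a₁ * b₁ + a₁ * b₂ + a₂ * b₂) (α β γ : ℤ) (hg : α * ℓ + β * m + γ * n = 1) :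
    IsLeast {k | 0 < k ∧ k * ℓ ∈ AddSubmonoid.closure ({m, n} : Set ℕ)} (a₁ + a₂) := by
  constructor
  · refine ⟨by omega, ?_⟩
    rw [AddSubmonoid.mem_closure_pair]
    refine ⟨b₁, c₂, ?_⟩
    simp only [smul_eq_mul]
    subst hl hm hn
    ring
  · rintro k ⟨hk, hmem⟩
    rw [AddSubmonoid.mem_closure_pair] at hmem
    obtain ⟨y, z, he⟩ := hmem
    simp only [smul_eq_mul] at he
    have he' : (y : ℤ) * m + z * n = k * ℓ := by exact_mod_cast he
    have hl' : (ℓ : ℤ) = b₁ * c₁ + b₁ * c₂ + b₂ * c₂ := by exact_mod_cast hl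
    have hm' : (m : ℤ) = a₁ * c₁ + a₂ * c₁ + a₂ * c₂ := by exact_mod_cast hm
    have hn' : (n : ℤ) = a₁ * b₁ + a₁ * b₂ + a₂ * b₂ := by exact_mod_cast hn
    clear hl hm hn he
    have key : ∃ p q : ℤ, (k : ℤ) = p * (a₁ + a₂) - q * a₂ ∧ (y : ℤ) = p * b₁ - q * (b₁ + b₂) ∧
        (z : ℤ) = p * c₂ + q * c₁ := by
      rw [hl', hm', hn'] at he' hg
      refine ⟨α * (y * c₁ + z * (b₁ + b₂)) + β * (z * a₂ + k * c₁)
          + γ * (k * (b₁ + b₂) - y * a₂),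
        α * (b₁ * z - c₂ * y) + β * (-c₂ * k + (a₁ + a₂) * z)
          + γ * (-(a₁ + a₂) * y + b₁ * k), ?_, ?_, ?_⟩
      · linear_combination (-(k : ℤ)) * hg - α * he'
      · linear_combination (-(y : ℤ)) * hg + β * he'
      · linear_combination (-(z : ℤ)) * hg + γ * he'
    obtain ⟨p, q, h1, h2, h3⟩ := key
    have hk' : (0 : ℤ) < k := by exact_mod_cast hk
    have hy' : (0 : ℤ) ≤ y := by positivity
    have hz' : (0 : ℤ) ≤ z := by positivity
    have A1 : (0 : ℤ) < a₁ := by exact_mod_cast ha₁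
    have A2 : (0 : ℤ) < a₂ := by exact_mod_cast ha₂
    have B1 : (0 : ℤ) < b₁ := by exact_mod_cast hb₁
    have B2 : (0 : ℤ) < b₂ := by exact_mod_cast hb₂
    have C1 : (0 : ℤ) < c₁ := by exact_mod_cast hc₁
    have C2 : (0 : ℤ) < c₂ := by exact_mod_cast hc₂
    have goal : (a₁ : ℤ) + a₂ ≤ k := by
      rcases le_or_gt q 0 with hq | hq
      · have hp : 0 < p := by
          by_contra hp
          push Not at hp
          have t1 : p * c₂ ≤ 0 := mul_nonpos_of_nonpos_of_nonneg hp C2.le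
          have t2 : q * c₁ ≤ 0 := mul_nonpos_of_nonpos_of_nonneg hq C1.le
          have t3 : q * c₁ = 0 := by linarith
          have t4 : q = 0 := by
            rcases mul_eq_zero.mp t3 with h | h
            · exact h
            · omega
          subst t4
          have : p * (a₁ + a₂ : ℤ) ≤ 0 := mul_nonpos_of_nonpos_of_nonneg hp (by omega)
          linarith
        nlinarith
      · have hp : q < p := by
          by_contra hp
          push Not at hp
          have := mul_le_mul_of_nonneg_right hp B1.le
          have := mul_pos hq B2
          linarith
        nlinarith
    exact_mod_cast goal

/-- Given (H1), the triple is the expected one. -/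
lemma h1_eq (ℓ m n a₁ a₂ b₁ b₂ c₁ c₂ : ℕ) (H : HerzogH1 ℓ m n a₁ a₂ b₁ b₂ c₁ c₂) :
    ℓ = b₁ * c₁ + b₁ * c₂ + b₂ * c₂ ∧ m = a₁ * c₁ + a₂ * c₁ + a₂ * c₂ ∧
      n = a₁ * b₁ + a₁ * b₂ + a₂ * b₂ := by
  obtain ⟨hℓ, hm, hn, hg, ha₁, ha₂, hb₁, hb₂, hc₁, hc₂, r1, r2, r3, m1, m2, m3⟩ := H
  have gen := lattice_gen_s3 ℓ m n a₁ a₂ b₁ b₂ c₁ c₂ (by exact_mod_cast hℓ) (by exact_mod_cast hm)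
    (by exact_mod_cast hn) (by exact_mod_cast ha₁) (by exact_mod_cast ha₂)
    (by exact_mod_cast hb₁) (by exact_mod_cast hb₂) (by exact_mod_cast hc₁)
    (by exact_mod_cast hc₂) (by exact_mod_cast r1) (by exact_mod_cast r2) (by exact_mod_cast r3)
    (by simpa using min_int_s3 _ _ _ _ m1) (by simpa using min_int_s3 _ _ _ _ m2)
    (by simpa using min_int_s3 _ _ _ _ m3)
  have gen' : ∀ x y z : ℤ, x * ℓ + y * m + z * n = 0 →
      ∃ p q : ℤ, x = p * (a₁ + a₂) - q * a₂ ∧ y = -p * b₁ + q * (b₁ + b₂) ∧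
        z = -p * c₂ - q * c₁ := by
    intro x y z h
    refine gen (|x| * ℓ + |y| * m + |z| * n + 1).toNat x y z h ?_
    rw [Int.toNat_of_nonneg (by positivity)]
    omega
  clear gen m1 m2 m3
  set L := b₁ * c₁ + b₁ * c₂ + b₂ * c₂ with hL
  set M := a₁ * c₁ + a₂ * c₁ + a₂ * c₂ with hM
  set N := a₁ * b₁ + a₁ * b₂ + a₂ * b₂ with hN
  have r1' : ((a₁ : ℤ) + a₂) * ℓ = b₁ * m + c₂ * n := by exact_mod_cast r1
  have r2' : ((b₁ : ℤ) + b₂) * m = a₂ * ℓ + c₁ * n := by exact_mod_cast r2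
  have hL' : (L : ℤ) = b₁ * c₁ + b₁ * c₂ + b₂ * c₂ := by exact_mod_cast hL
  have hM' : (M : ℤ) = a₁ * c₁ + a₂ * c₁ + a₂ * c₂ := by exact_mod_cast hM
  have hN' : (N : ℤ) = a₁ * b₁ + a₁ * b₂ + a₂ * b₂ := by exact_mod_cast hN
  have lm : (L : ℤ) * m = M * ℓ := by
    rw [hL', hM']; linear_combination (-(c₁ : ℤ)) * r1' + (c₂ : ℤ) * r2'
  have ln : (L : ℤ) * n = N * ℓ := by
    rw [hL', hN']; linear_combination (-((b₁ : ℤ) + b₂)) * r1' - (b₁ : ℤ) * r2'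
  have hdvd : ℓ ∣ L := by
    have d1 : ℓ ∣ L * ℓ := Dvd.intro_left _ rfl
    have d2 : ℓ ∣ L * m := ⟨M, by rw [mul_comm ℓ M]; exact_mod_cast lm⟩
    have d3 : ℓ ∣ L * n := ⟨N, by rw [mul_comm ℓ N]; exact_mod_cast ln⟩
    have d4 : ℓ ∣ L * Nat.gcd (Nat.gcd ℓ m) n := by
      rw [← Nat.gcd_mul_left, ← Nat.gcd_mul_left]
      exact Nat.dvd_gcd (Nat.dvd_gcd d1 d2) d3
    rwa [hg, mul_one] at d4
  obtain ⟨e, he⟩ := hdvd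
  have he' : (L : ℤ) = ℓ * e := by exact_mod_cast he
  have hl0 : (ℓ : ℤ) ≠ 0 := by exact_mod_cast hℓ.ne'
  have hm0 : (m : ℤ) ≠ 0 := by exact_mod_cast hm.ne'
  have hn0 : (n : ℤ) ≠ 0 := by exact_mod_cast hn.ne'
  have hMe : (M : ℤ) = m * e := by
    apply mul_right_cancel₀ hl0
    rw [← lm, he']; ring
  have hNe : (N : ℤ) = n * e := by
    apply mul_right_cancel₀ hl0
    rw [← ln, he']; ring
  obtain ⟨p1, q1, x1, y1, z1⟩ := gen' m (-ℓ) 0 (by ring)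
  obtain ⟨p2, q2, x2, y2, z2⟩ := gen' n 0 (-ℓ) (by ring)
  obtain ⟨p3, q3, x3, y3, z3⟩ := gen' 0 n (-m) (by ring)
  -- cross products of pairs of relations
  have D1 : (e : ℤ) ∣ ℓ := by
    refine ⟨p1 * q2 - p2 * q1, ?_⟩
    apply mul_right_cancel₀ hl0
    have : (ℓ : ℤ) * ℓ = (p1 * q2 - p2 * q1) * L := by
      have : (ℓ : ℤ) * ℓ = (-ℓ : ℤ) * (-ℓ) - 0 * 0 := by ring
      rw [this]
      nth_rewrite 1 [y1]
      rw [z2, hL']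
      have : (0 : ℤ) * 0 = (-p1 * c₂ - q1 * c₁) * (-p2 * b₁ + q2 * (b₁ + b₂)) := by
        rw [← z1, ← y2]
      rw [this]; ring
    rw [this, he']; ring
  have D2 : (e : ℤ) ∣ m := by
    refine ⟨p1 * q3 - p3 * q1, ?_⟩
    apply mul_right_cancel₀ hm0
    have : (m : ℤ) * m = (p1 * q3 - p3 * q1) * M := by
      have t : (m : ℤ) * m = 0 * 0 - m * (-m) := by ring
      have t1 : (m : ℤ) * (-m) = (p1 * (a₁ + a₂) - q1 * a₂) * (-p3 * c₂ - q3 * c₁) := by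
        rw [← x1, ← z3]
      have t2 : (0 : ℤ) * 0 = (-p1 * c₂ - q1 * c₁) * (p3 * (a₁ + a₂) - q3 * a₂) := by
        rw [← z1, ← x3]
      rw [t, t1, t2, hM']; ring
    rw [this, hMe]; ring
  have D3 : (e : ℤ) ∣ n := by
    refine ⟨p2 * q3 - p3 * q2, ?_⟩
    apply mul_right_cancel₀ hn0
    have : (n : ℤ) * n = (p2 * q3 - p3 * q2) * N := by
      have t : (n : ℤ) * n = n * n - 0 * 0 := by ring
      have t1 : (n : ℤ) * n =
          (p2 * (a₁ + a₂) - q2 * a₂) * (-p3 * b₁ + q3 * (b₁ + b₂)) := by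
        rw [← x2, ← y3]
      have t2 : (0 : ℤ) * 0 = (-p2 * b₁ + q2 * (b₁ + b₂)) * (p3 * (a₁ + a₂) - q3 * a₂) := by
        rw [← y2, ← x3]
      rw [t, t1, t2, hN']; ring
    rw [this, hNe]; ring
  have e1 : e = 1 := by
    have : e ∣ Nat.gcd (Nat.gcd ℓ m) n :=
      Nat.dvd_gcd (Nat.dvd_gcd (by exact_mod_cast D1) (by exact_mod_cast D2)) (by exact_mod_cast D3)
    rw [hg] at this
    exact Nat.dvd_one.mp this
  subst e1
  refine ⟨?_, ?_, ?_⟩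
  · omega
  · have : (M : ℤ) = m := by simpa using hMe
    exact_mod_cast this.symm
  · have : (N : ℤ) = n := by simpa using hNe
    exact_mod_cast this.symm

lemma bezout3 (x y z : ℕ) (h : Nat.gcd (Nat.gcd x y) z = 1) :
    ∃ α β γ : ℤ, α * x + β * y + γ * z = 1 := by
  have h1 := Nat.gcd_eq_gcd_ab (Nat.gcd x y) z
  have h2 := Nat.gcd_eq_gcd_ab x y
  rw [h, h2] at h1
  exact ⟨Nat.gcdA x y * Nat.gcdA (Nat.gcd x y) z, Nat.gcdB x y * Nat.gcdA (Nat.gcd x y) z,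
    Nat.gcdB (Nat.gcd x y) z, by push_cast at h1; linarith⟩

/-- Proposition 7(a): the data `a₁,a₂,b₁,b₂,c₁,c₂` arise through Herzog's case (H1) from
some numerical semigroup `⟨ℓ,m,n⟩` if and only if `e' = gcd(ℓ',m',n') = 1`, in which case
`(ℓ,m,n) = (ℓ',m',n')`. -/
theorem prop7a (a₁ a₂ b₁ b₂ c₁ c₂ : ℕ)
    (ha₁ : 0 < a₁) (ha₂ : 0 < a₂) (hb₁ : 0 < b₁) (hb₂ : 0 < b₂) (hc₁ : 0 < c₁) (hc₂ : 0 < c₂) :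
    ((∃ ℓ m n : ℕ, HerzogH1 ℓ m n a₁ a₂ b₁ b₂ c₁ c₂) ↔
      Nat.gcd (Nat.gcd (b₁ * c₁ + b₁ * c₂ + b₂ * c₂) (a₁ * c₁ + a₂ * c₁ + a₂ * c₂))
        (a₁ * b₁ + a₁ * b₂ + a₂ * b₂) = 1) ∧
    (∀ ℓ m n : ℕ, HerzogH1 ℓ m n a₁ a₂ b₁ b₂ c₁ c₂ →
      (ℓ, m, n) = (b₁ * c₁ + b₁ * c₂ + b₂ * c₂, a₁ * c₁ + a₂ * c₁ + a₂ * c₂,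
        a₁ * b₁ + a₁ * b₂ + a₂ * b₂)) := by
  refine ⟨⟨?_, ?_⟩, ?_⟩
  · rintro ⟨ℓ, m, n, H⟩
    obtain ⟨h1, h2, h3⟩ := h1_eq _ _ _ _ _ _ _ _ _ H
    rw [← h1, ← h2, ← h3]
    exact H.2.2.2.1
  · intro hg
    obtain ⟨α, β, γ, hb⟩ := bezout3 _ _ _ hg
    refine ⟨_, _, _, by positivity, by positivity, by positivity, hg, ha₁, ha₂, hb₁, hb₂, hc₁, hc₂,
      by ring, by ring, by ring, ?_, ?_, ?_⟩
    · exact min_nat _ _ _ a₁ a₂ b₁ b₂ c₁ c₂ ha₁ ha₂ hb₁ hb₂ hc₁ hc₂ rfl rfl rfl α β γ hb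
    · rw [Set.pair_comm]
      exact min_nat _ _ _ b₁ b₂ c₁ c₂ a₁ a₂ hb₁ hb₂ hc₁ hc₂ ha₁ ha₂ (by ring) (by ring) (by ring)
        β γ α (by linarith)
    · exact min_nat _ _ _ c₁ c₂ a₁ a₂ b₁ b₂ hc₁ hc₂ ha₁ ha₂ hb₁ hb₂ (by ring) (by ring) (by ring)
        γ α β (by linarith)
  · intro ℓ m n H
    obtain ⟨h1, h2, h3⟩ := h1_eq _ _ _ _ _ _ _ _ _ H
    rw [← h1, ← h2, ← h3]
end

section
/- Let R be a commutative ring and let a₁,a₂,b₁,b₂,c₁,c₂ be positive integers; set a = a₁+a₂, c = c₁+c₂, ℓ' = b₁·c + b₂·c₂, and in R[x,y,z] put f₁ = x^a − y^{b₁}z^{c₂} and f₃ = x^{a₁}y^{b₂} − z^c. Then there exist q, g ∈ R[x,y,z] and a sign ε ∈ {1,−1} such that f₁^c = q·f₃ + x^{a₁c₂}·g and g − ε·y^{ℓ'} lies in the ideal ⟨x,z⟩ of R[x,y,z]. (Bresinsky's identity, equation (35)) -/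
open MvPolynomial

lemma bres_pow_mem {S : Type*} [CommRing S] (I : Ideal S) (u v : S) (h : u - v ∈ I) (n : ℕ) :
    v ^ n - u ^ n ∈ I := by
  have h1 : u - v ∣ u ^ n - v ^ n := sub_dvd_pow_sub_pow u v n
  have h2 := I.mem_of_dvd h1 h
  have h3 := I.neg_mem h2
  rwa [neg_sub] at h3

lemma bres_term {S : Type*} [CommRing S] (x y z : S) (a₁ a₂ b₂ c₁ c₂ k : ℕ)
    (ha₁ : 0 < a₁) (ha₂ : 0 < a₂) (hk : 0 < k) (hkc : k ≤ c₁ + c₂) (I : Ideal S)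
    (h1 : x ^ a₁ * y ^ b₂ - z ^ (c₁ + c₂) ∈ I) (h2 : x ^ (a₁ * c₂ + 1) ∈ I) :
    x ^ ((a₁ + a₂) * k) * z ^ (c₂ * (c₁ + c₂ - k)) ∈ I := by
  have hk2 : 0 < a₂ * k := Nat.mul_pos ha₂ hk
  rcases le_total c₂ k with h | h
  · apply I.mul_mem_right
    refine I.mem_of_dvd (pow_dvd_pow x ?_) h2
    have := Nat.mul_le_mul_left a₁ h
    rw [add_mul]; omega
  · obtain ⟨d, rfl⟩ := Nat.exists_eq_add_of_le h
    have e : (k + d) * (c₁ + (k + d) - k) = (c₁ + (k + d)) * d + c₁ * k := by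
      have : c₁ + (k + d) - k = c₁ + d := by omega
      rw [this]; ring
    have h3 := bres_pow_mem I _ _ h1 d
    have h4 : x ^ ((a₁ + a₂) * k) * (x ^ a₁ * y ^ b₂) ^ d ∈ I := by
      have e2 : x ^ ((a₁ + a₂) * k) * (x ^ a₁ * y ^ b₂) ^ d
          = x ^ (a₁ * (k + d) + a₂ * k) * y ^ (b₂ * d) := by ring
      rw [e2]
      exact I.mul_mem_right _ (I.mem_of_dvd (pow_dvd_pow x (by omega)) h2)
    have h5 := I.add_mem (I.mul_mem_left (x ^ ((a₁ + a₂) * k) * z ^ (c₁ * k)) h3)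
      (I.mul_mem_left (z ^ (c₁ * k)) h4)
    rw [e, pow_add, pow_mul z]
    convert h5 using 1
    ring

lemma bres_main {S : Type*} [CommRing S] (x y z : S) (a₁ a₂ b₁ b₂ c₁ c₂ : ℕ)
    (ha₁ : 0 < a₁) (ha₂ : 0 < a₂) (I : Ideal S)
    (h1 : x ^ a₁ * y ^ b₂ - z ^ (c₁ + c₂) ∈ I) (h2 : x ^ (a₁ * c₂ + 1) ∈ I) :
    (x ^ (a₁ + a₂) - y ^ b₁ * z ^ c₂) ^ (c₁ + c₂) -
      (-1) ^ (c₁ + c₂) * x ^ (a₁ * c₂) * y ^ (b₁ * (c₁ + c₂) + b₂ * c₂) ∈ I := by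
  rw [sub_eq_add_neg (x ^ (a₁ + a₂)), add_pow, Finset.sum_range_succ', add_sub_assoc]
  apply I.add_mem
  · apply I.sum_mem
    intro k hk
    rw [Finset.mem_range] at hk
    have := bres_term x y z a₁ a₂ b₂ c₁ c₂ (k + 1) ha₁ ha₂ (by omega) (by omega) I h1 h2
    apply I.mul_mem_right
    rw [neg_eq_neg_one_mul, mul_pow, mul_pow, ← pow_mul, ← pow_mul z]
    convert I.mul_mem_left ((-1) ^ (c₁ + c₂ - (k + 1)) * (y ^ b₁) ^ (c₁ + c₂ - (k + 1))) this using 1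
    ring
  · have h3 := bres_pow_mem I _ _ h1 c₂
    convert I.mul_mem_left ((-1) ^ (c₁ + c₂) * y ^ (b₁ * (c₁ + c₂))) h3 using 1
    simp only [pow_zero, Nat.sub_zero, Nat.choose_zero_right, Nat.cast_one, one_mul, mul_one]
    rw [neg_eq_neg_one_mul (y ^ b₁ * _), mul_pow, mul_pow, mul_pow, ← pow_mul, ← pow_mul, ← pow_mul,
      ← pow_mul, ← pow_mul, mul_comm c₂ (c₁ + c₂), pow_add y]
    generalize c₁ + c₂ = c
    ring

/-- Bresinsky's identity (equation (35)): in `R[x,y,z]`, one has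
`f₁^c = q·f₃ + x^{a₁c₂}·g` with `g ≡ ε·y^{ℓ'} mod ⟨x,z⟩` for a sign `ε`. -/
theorem bresinsky_identity (R : Type*) [CommRing R] (a₁ a₂ b₁ b₂ c₁ c₂ : ℕ)
    (ha₁ : 0 < a₁) (ha₂ : 0 < a₂) (hb₁ : 0 < b₁) (hb₂ : 0 < b₂) (hc₁ : 0 < c₁) (hc₂ : 0 < c₂) :
    ∃ (q g : MvPolynomial (Fin 3) R) (ε : R), (ε = 1 ∨ ε = -1) ∧
      ((X 0 : MvPolynomial (Fin 3) R) ^ (a₁ + a₂) - X 1 ^ b₁ * X 2 ^ c₂) ^ (c₁ + c₂) =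
        q * (X 0 ^ a₁ * X 1 ^ b₂ - X 2 ^ (c₁ + c₂)) + X 0 ^ (a₁ * c₂) * g ∧
      g - C ε * X 1 ^ (b₁ * (c₁ + c₂) + b₂ * c₂) ∈
        Ideal.span ({X 0, X 2} : Set (MvPolynomial (Fin 3) R)) := by
  have h := bres_main (X 0 : MvPolynomial (Fin 3) R) (X 1) (X 2) a₁ a₂ b₁ b₂ c₁ c₂ ha₁ ha₂
    (Ideal.span {X 0 ^ a₁ * X 1 ^ b₂ - X 2 ^ (c₁ + c₂), X 0 ^ (a₁ * c₂ + 1)})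
    (Ideal.subset_span (by simp)) (Ideal.subset_span (by simp))
  obtain ⟨q, t, ht⟩ := Ideal.mem_span_pair.1 h
  refine ⟨q, t * X 0 + C ((-1) ^ (c₁ + c₂)) * X 1 ^ (b₁ * (c₁ + c₂) + b₂ * c₂),
    (-1) ^ (c₁ + c₂), neg_one_pow_eq_or R _, ?_, ?_⟩
  · rw [eq_comm, sub_eq_iff_eq_add] at ht
    rw [ht, map_pow, map_neg, map_one, pow_succ]
    ring
  · rw [add_sub_cancel_right]
    exact Ideal.mul_mem_left _ _ (Ideal.subset_span (by simp))
end

section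
/- Let K be an algebraically closed field and let ℓ, m, n with gcd(ℓ,m,n) = 1 be in Herzog's case (H1) with data a₁,a₂,b₁,b₂,c₁,c₂, with defining ideal I = ker φ. Put f₁ = x^a − y^{b₁}z^{c₂}, f₃ = x^{a₁}y^{b₂} − z^c and ℓ' = b₁·c + b₂·c₂, and let g ∈ K[x,y,z] be any polynomial such that f₁^c = q·f₃ + x^{a₁c₂}·g for some q ∈ K[x,y,z] and g ≡ ε·y^{ℓ'} modulo ⟨x,z⟩ for a sign ε ∈ {1,−1}. Then the radical of the ideal ⟨g, f₃⟩ of K[x,y,z] equals I; in particular the monomial space curve defined by I is a set-theoretic complete intersection. (Bresinsky's theorem as proved via (40)) -/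
open MvPolynomial

/-- Descent step: subtracting a Herzog relation lowers the positive weight. -/
lemma weight_step (l m n a b c u v w : ℤ) (hl : 0 < l) (hm : 0 < m) (hn : 0 < n)
    (hb : 0 < b) (hc : 0 < c) (hrel : a * l = b * m + c * n)
    (hu : 0 < u) (hv : v ≤ 0) (hw : w ≤ 0) (hN : l * u + m * v + n * w = 0) (hau : a ≤ u) :
    l * max 0 (u - a) + m * max 0 (v + b) + n * max 0 (w + c) <
      l * max 0 u + m * max 0 v + n * max 0 w := by
  rw [max_eq_right (by linarith : 0 ≤ u - a), max_eq_right hu.le, max_eq_left hv, max_eq_left hw]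
  have h1 : max 0 (v + b) ≤ b := by omega
  have h2 : max 0 (w + c) ≤ c := by omega
  have h1' := mul_le_mul_of_nonneg_left h1 hm.le
  have h2' := mul_le_mul_of_nonneg_left h2 hn.le
  rcases lt_or_eq_of_le hv with h | h
  · have h3 : max 0 (v + b) < b := by omega
    have h3' := mul_lt_mul_of_pos_left h3 hm
    nlinarith
  · rcases lt_or_eq_of_le hw with h' | h'
    · have h3 : max 0 (w + c) < c := by omega
      have h3' := mul_lt_mul_of_pos_left h3 hn
      nlinarith
    · subst h h'
      nlinarith [mul_pos hl hu]

/-- Minimality of a Herzog exponent, in integer form. -/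
lemma least_int (l m n a : ℕ)
    (h : IsLeast {k | 0 < k ∧ k * l ∈ AddSubmonoid.closure ({m, n} : Set ℕ)} a)
    (u v w : ℤ) (hu : 0 < u) (hv : v ≤ 0) (hw : w ≤ 0)
    (hN : (l : ℤ) * u + m * v + n * w = 0) : (a : ℤ) ≤ u := by
  have : a ≤ u.toNat := by
    apply h.2
    refine ⟨by omega, ?_⟩
    rw [AddSubmonoid.mem_closure_pair]
    refine ⟨(-v).toNat, (-w).toNat, ?_⟩
    zify
    simp only [smul_eq_mul]
    push_cast
    rw [Int.toNat_of_nonneg (by omega), Int.toNat_of_nonneg (by omega),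
      Int.toNat_of_nonneg (by omega)]
    linarith
  omega

/-- The lattice of relations is generated by the three Herzog relations. -/
lemma lattice_gen_s8 (l m n a₁ a₂ b₁ b₂ c₁ c₂ : ℕ)
    (h : HerzogH1 l m n a₁ a₂ b₁ b₂ c₁ c₂) (N : ℕ) : ∀ u v w : ℤ,
    (l : ℤ) * u + m * v + n * w = 0 →
    (l : ℤ) * max 0 u + m * max 0 v + n * max 0 w < N →
    ∃ i j k : ℤ, u = i * (a₁ + a₂) - j * a₂ - k * a₁ ∧ v = - i * b₁ + j * (b₁ + b₂) - k * b₂ ∧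
      w = - i * c₂ - j * c₁ + k * (c₁ + c₂) := by
  obtain ⟨hl, hm, hn, -, ha1, ha2, hb1, hb2, hc1, hc2, r1, r2, r3, L1, L2, L3⟩ := h
  zify at hl hm hn ha1 ha2 hb1 hb2 hc1 hc2 r1 r2 r3
  induction N with
  | zero =>
    intro u v w _ hW
    have h1 := mul_nonneg hl.le (le_max_left 0 u)
    have h2 := mul_nonneg hm.le (le_max_left 0 v)
    have h3 := mul_nonneg hn.le (le_max_left 0 w)
    push_cast at hW
    linarith
  | succ N ih =>
    have key : ∀ u v w : ℤ, (l : ℤ) * u + m * v + n * w = 0 →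
        (l : ℤ) * max 0 u + m * max 0 v + n * max 0 w < (N + 1 : ℕ) →
        (0 < u ∧ v ≤ 0 ∧ w ≤ 0 ∨ 0 < v ∧ u ≤ 0 ∧ w ≤ 0 ∨ 0 < w ∧ u ≤ 0 ∧ v ≤ 0) →
        ∃ i j k : ℤ, u = i * (a₁ + a₂) - j * a₂ - k * a₁ ∧
          v = - i * b₁ + j * (b₁ + b₂) - k * b₂ ∧
          w = - i * c₂ - j * c₁ + k * (c₁ + c₂) := by
      intro u v w hN hW hs
      push_cast at hW
      rcases hs with ⟨hu, hv, hw⟩ | ⟨hv, hu, hw⟩ | ⟨hw, hu, hv⟩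
      · have hle := least_int _ _ _ _ L1 u v w hu hv hw hN
        push_cast at hle
        have := weight_step l m n (a₁ + a₂) b₁ c₂ u v w hl hm hn hb1 hc2 r1 hu hv hw hN hle
        obtain ⟨i, j, k, e1, e2, e3⟩ := ih (u - (a₁ + a₂)) (v + b₁) (w + c₂)
          (by linarith) (by linarith)
        exact ⟨i + 1, j, k, by linarith, by linarith, by linarith⟩
      · have hle := least_int _ _ _ _ L2 v u w hv hu hw (by linarith)
        push_cast at hle
        have := weight_step m l n (b₁ + b₂) a₂ c₁ v u w hm hl hn ha2 hc1 r2 hv hu hw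
          (by linarith) hle
        obtain ⟨i, j, k, e1, e2, e3⟩ := ih (u + a₂) (v - (b₁ + b₂)) (w + c₁)
          (by linarith) (by linarith)
        exact ⟨i, j + 1, k, by linarith, by linarith, by linarith⟩
      · have hle := least_int _ _ _ _ L3 w u v hw hu hv (by linarith)
        push_cast at hle
        have := weight_step n l m (c₁ + c₂) a₁ b₂ w u v hn hl hm ha1 hb2 r3 hw hu hv
          (by linarith) hle
        obtain ⟨i, j, k, e1, e2, e3⟩ := ih (u + a₁) (v + b₂) (w - (c₁ + c₂))
          (by linarith) (by linarith)
        exact ⟨i, j, k + 1, by linarith, by linarith, by linarith⟩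
    intro u v w hN hW
    have hmax : ∀ t : ℤ, max 0 (-t) = max 0 t - t := by intro t; omega
    have neg : (0 < -u ∧ -v ≤ 0 ∧ -w ≤ 0 ∨ 0 < -v ∧ -u ≤ 0 ∧ -w ≤ 0 ∨
        0 < -w ∧ -u ≤ 0 ∧ -v ≤ 0) → ∃ i j k : ℤ, u = i * (a₁ + a₂) - j * a₂ - k * a₁ ∧
          v = - i * b₁ + j * (b₁ + b₂) - k * b₂ ∧
          w = - i * c₂ - j * c₁ + k * (c₁ + c₂) := by
      intro hs
      obtain ⟨i, j, k, e1, e2, e3⟩ := key (-u) (-v) (-w) (by linarith)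
        (by rw [hmax, hmax, hmax]; linarith) hs
      exact ⟨-i, -j, -k, by linarith, by linarith, by linarith⟩
    by_cases h0 : u = 0 ∧ v = 0 ∧ w = 0
    · obtain ⟨rfl, rfl, rfl⟩ := h0
      exact ⟨0, 0, 0, by simp, by simp, by simp⟩
    by_cases hp : (0 < u ∧ v ≤ 0 ∧ w ≤ 0 ∨ 0 < v ∧ u ≤ 0 ∧ w ≤ 0 ∨ 0 < w ∧ u ≤ 0 ∧ v ≤ 0)
    · exact key u v w hN hW hp
    by_cases hq : (0 < -u ∧ -v ≤ 0 ∧ -w ≤ 0 ∨ 0 < -v ∧ -u ≤ 0 ∧ -w ≤ 0 ∨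
        0 < -w ∧ -u ≤ 0 ∧ -v ≤ 0)
    · exact neg hq
    exfalso
    have hcase : (0 ≤ u ∧ 0 ≤ v ∧ 0 ≤ w) ∨ (u ≤ 0 ∧ v ≤ 0 ∧ w ≤ 0) := by omega
    rcases hcase with ⟨h1, h2, h3⟩ | ⟨h1, h2, h3⟩
    · have p1 := mul_nonneg hl.le h1
      have p2 := mul_nonneg hm.le h2
      have p3 := mul_nonneg hn.le h3
      apply h0
      refine ⟨?_, ?_, ?_⟩
      · exact (mul_eq_zero.1 (by linarith : (l : ℤ) * u = 0)).resolve_left hl.ne'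
      · exact (mul_eq_zero.1 (by linarith : (m : ℤ) * v = 0)).resolve_left hm.ne'
      · exact (mul_eq_zero.1 (by linarith : (n : ℤ) * w = 0)).resolve_left hn.ne'
    · have p1 := mul_nonpos_of_nonneg_of_nonpos hl.le h1
      have p2 := mul_nonpos_of_nonneg_of_nonpos hm.le h2
      have p3 := mul_nonpos_of_nonneg_of_nonpos hn.le h3
      apply h0
      refine ⟨?_, ?_, ?_⟩
      · exact (mul_eq_zero.1 (by linarith : (l : ℤ) * u = 0)).resolve_left hl.ne'
      · exact (mul_eq_zero.1 (by linarith : (m : ℤ) * v = 0)).resolve_left hm.ne'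
      · exact (mul_eq_zero.1 (by linarith : (n : ℤ) * w = 0)).resolve_left (ne_of_gt hn)

/-- Units satisfying the first and third Herzog relations lie on the curve. -/
lemma exists_param {G : Type*} [CommGroup G] (l m n a₁ a₂ b₁ b₂ c₁ c₂ : ℕ)
    (h : HerzogH1 l m n a₁ a₂ b₁ b₂ c₁ c₂) (x y z : G)
    (h1 : x ^ (a₁ + a₂) = y ^ b₁ * z ^ c₂) (h3 : x ^ a₁ * y ^ b₂ = z ^ (c₁ + c₂)) :
    ∃ t : G, t ^ l = x ∧ t ^ m = y ∧ t ^ n = z := by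
  have hker : ∀ u v w : ℤ, (l : ℤ) * u + m * v + n * w = 0 → x ^ u * y ^ v * z ^ w = 1 := by
    intro u v w hN
    obtain ⟨N, hN'⟩ : ∃ N : ℕ, (l : ℤ) * max 0 u + m * max 0 v + n * max 0 w < N :=
      ⟨((l : ℤ) * max 0 u + m * max 0 v + n * max 0 w + 1).toNat, by omega⟩
    obtain ⟨i, j, k, e1, e2, e3⟩ := lattice_gen_s8 l m n a₁ a₂ b₁ b₂ c₁ c₂ h N u v w hN hN'
    have g1 : x ^ ((a₁ : ℤ) + a₂) * y ^ (-(b₁ : ℤ)) * z ^ (-(c₂ : ℤ)) = 1 := by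
      have : x ^ ((a₁ : ℤ) + a₂) = y ^ (b₁ : ℤ) * z ^ (c₂ : ℤ) := by exact_mod_cast h1
      rw [this, zpow_neg, zpow_neg]
      simp
    have g3 : x ^ (-(a₁ : ℤ)) * y ^ (-(b₂ : ℤ)) * z ^ ((c₁ : ℤ) + c₂) = 1 := by
      have : x ^ (a₁ : ℤ) * y ^ (b₂ : ℤ) = z ^ ((c₁ : ℤ) + c₂) := by exact_mod_cast h3
      rw [← this, zpow_neg, zpow_neg, ← mul_inv, inv_mul_cancel]
    have g : (x ^ ((a₁ : ℤ) + a₂) * y ^ (-(b₁ : ℤ)) * z ^ (-(c₂ : ℤ))) ^ (i - j) *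
        (x ^ (-(a₁ : ℤ)) * y ^ (-(b₂ : ℤ)) * z ^ ((c₁ : ℤ) + c₂)) ^ (k - j) = 1 := by
      rw [g1, g3, one_zpow, one_zpow, one_mul]
    rw [← g]
    simp only [mul_zpow, ← zpow_mul]
    rw [show u = ((a₁ : ℤ) + a₂) * (i - j) + (-(a₁ : ℤ)) * (k - j) by rw [e1]; ring,
      show v = (-(b₁ : ℤ)) * (i - j) + (-(b₂ : ℤ)) * (k - j) by rw [e2]; ring,
      show w = (-(c₂ : ℤ)) * (i - j) + ((c₁ : ℤ) + c₂) * (k - j) by rw [e3]; ring]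
    simp only [zpow_add]
    ac_rfl
  obtain ⟨p, q, r, hpqr⟩ : ∃ p q r : ℤ, p * l + q * m + r * n = 1 := by
    have e1 := Nat.gcd_eq_gcd_ab l m
    have e2 := Nat.gcd_eq_gcd_ab (Nat.gcd l m) n
    rw [h.2.2.2.1, e1] at e2
    refine ⟨Nat.gcdA l m * Nat.gcdA (Nat.gcd l m) n, Nat.gcdB l m * Nat.gcdA (Nat.gcd l m) n,
      Nat.gcdB (Nat.gcd l m) n, ?_⟩
    push_cast at e2
    linear_combination -e2
  refine ⟨x ^ p * y ^ q * z ^ r, ?_, ?_, ?_⟩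
  · have := hker (p * l - 1) (q * l) (r * l) (by linear_combination (l : ℤ) * hpqr)
    rw [zpow_sub_one] at this
    rw [← zpow_natCast, mul_zpow, mul_zpow, ← zpow_mul, ← zpow_mul, ← zpow_mul]
    rw [← mul_inv_eq_one, ← this]
    ac_rfl
  · have := hker (p * m) (q * m - 1) (r * m) (by linear_combination (m : ℤ) * hpqr)
    rw [zpow_sub_one] at this
    rw [← zpow_natCast, mul_zpow, mul_zpow, ← zpow_mul, ← zpow_mul, ← zpow_mul]
    rw [← mul_inv_eq_one, ← this]
    ac_rfl
  · have := hker (p * n) (q * n) (r * n - 1) (by linear_combination (n : ℤ) * hpqr)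
    rw [zpow_sub_one] at this
    rw [← zpow_natCast, mul_zpow, mul_zpow, ← zpow_mul, ← zpow_mul, ← zpow_mul]
    rw [← mul_inv_eq_one, ← this]
    ac_rfl

/-- Elements of the curve ideal vanish at the points `(t^ℓ, t^m, t^n)`. -/
lemma eval_curve (K : Type*) [Field K] (l m n : ℕ) (F : MvPolynomial (Fin 3) K)
    (hF : F ∈ monomialCurveIdeal K l m n) (P : Fin 3 → K) (t : K)
    (h0 : P 0 = t ^ l) (h1 : P 1 = t ^ m) (h2 : P 2 = t ^ n) : aeval P F = 0 := by
  have hF' : aeval (fun i : Fin 3 => (Polynomial.X : Polynomial K) ^ (![l, m, n] i)) F = 0 := hF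
  have hcomp : (aeval P : MvPolynomial (Fin 3) K →ₐ[K] K) = (Polynomial.aeval t).comp
      (aeval (fun i : Fin 3 => (Polynomial.X : Polynomial K) ^ (![l, m, n] i))) := by
    apply MvPolynomial.algHom_ext
    intro i
    fin_cases i <;> simp [h0, h1, h2]
  rw [hcomp, AlgHom.comp_apply, hF', map_zero]

/-- Bresinsky's theorem (via (40)): for any `g` with `f₁^c = q·f₃ + x^{a₁c₂}·g` and
`g ≡ ε·y^{ℓ'} mod ⟨x,z⟩`, the radical of `⟨g, f₃⟩` equals the defining ideal `I`;
in particular the monomial space curve is a set-theoretic complete intersection. -/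
theorem bresinsky (K : Type*) [Field K] [IsAlgClosed K] (ℓ m n a₁ a₂ b₁ b₂ c₁ c₂ : ℕ)
    (h : HerzogH1 ℓ m n a₁ a₂ b₁ b₂ c₁ c₂)
    (q g : MvPolynomial (Fin 3) K) (ε : K) (hε : ε = 1 ∨ ε = -1)
    (hg : ((X 0 : MvPolynomial (Fin 3) K) ^ (a₁ + a₂) - X 1 ^ b₁ * X 2 ^ c₂) ^ (c₁ + c₂) =
      q * (X 0 ^ a₁ * X 1 ^ b₂ - X 2 ^ (c₁ + c₂)) + X 0 ^ (a₁ * c₂) * g)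
    (hmod : g - C ε * X 1 ^ (b₁ * (c₁ + c₂) + b₂ * c₂) ∈
      Ideal.span ({X 0, X 2} : Set (MvPolynomial (Fin 3) K))) :
    (Ideal.span ({g, X 0 ^ a₁ * X 1 ^ b₂ - X 2 ^ (c₁ + c₂)} :
        Set (MvPolynomial (Fin 3) K))).radical = monomialCurveIdeal K ℓ m n := by
  obtain ⟨hl, hm, hn, -, ha1, ha2, hb1, hb2, hc1, hc2, r1, r2, r3, -⟩ := id h
  have hε0 : ε ≠ 0 := by rcases hε with rfl | rfl <;> simp
  have hprime : (monomialCurveIdeal K ℓ m n).IsPrime := RingHom.ker_isPrime _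
  have hf3 : (X 0 ^ a₁ * X 1 ^ b₂ - X 2 ^ (c₁ + c₂) : MvPolynomial (Fin 3) K) ∈
      monomialCurveIdeal K ℓ m n := by
    simp only [monomialCurveIdeal, RingHom.mem_ker]
    simp [← pow_mul, ← pow_add]
    rw [sub_eq_zero]
    congr 1
    linarith
  have hf1 : (X 0 ^ (a₁ + a₂) - X 1 ^ b₁ * X 2 ^ c₂ : MvPolynomial (Fin 3) K) ∈
      monomialCurveIdeal K ℓ m n := by
    simp only [monomialCurveIdeal, RingHom.mem_ker]
    simp [← pow_mul, ← pow_add]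
    rw [sub_eq_zero]
    congr 1
    linarith
  have hx : (X 0 : MvPolynomial (Fin 3) K) ∉ monomialCurveIdeal K ℓ m n := by
    simp [monomialCurveIdeal, RingHom.mem_ker]
  have hgI : g ∈ monomialCurveIdeal K ℓ m n := by
    have h1 : X 0 ^ (a₁ * c₂) * g ∈ monomialCurveIdeal K ℓ m n := by
      rw [eq_sub_iff_add_eq'.2 hg.symm]
      exact Ideal.sub_mem _ (Ideal.pow_mem_of_mem _ hf1 _ (by omega))
        (Ideal.mul_mem_left _ _ hf3)
    exact (hprime.mem_or_mem h1).resolve_left fun h2 => hx (hprime.mem_of_pow_mem _ h2)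
  apply le_antisymm
  · rw [hprime.radical_le_iff, Ideal.span_le]
    rintro f (rfl | rfl)
    · exact hgI
    · exact hf3
  intro F hF
  rw [← MvPolynomial.vanishingIdeal_zeroLocus_eq_radical (K := K), mem_vanishingIdeal_iff]
  intro P hP
  rw [mem_zeroLocus_iff] at hP
  have eg : aeval P g = 0 := hP g (Ideal.subset_span (by simp))
  have e3 := hP _ (Ideal.subset_span (Set.mem_insert_of_mem _ (Set.mem_singleton _)))
  simp only [map_sub, map_mul, map_pow, aeval_X] at e3
  by_cases hP0 : P 0 = 0
  · have hP2 : P 2 = 0 := by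
      rw [hP0, zero_pow ha1.ne'] at e3
      have : P 2 ^ (c₁ + c₂) = 0 := by linear_combination -e3
      exact pow_eq_zero_iff (by omega) |>.1 this
    have hP1 : P 1 = 0 := by
      rw [Ideal.mem_span_pair] at hmod
      obtain ⟨A, B, hAB⟩ := hmod
      have := congrArg (aeval P) hAB
      simp only [map_sub, map_add, map_mul, map_pow, aeval_X, aeval_C, eg, hP0, hP2] at this
      simp only [Algebra.algebraMap_self, RingHom.id_apply] at this
      have h' : ε * P 1 ^ (b₁ * (c₁ + c₂) + b₂ * c₂) = 0 := by linear_combination this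
      exact eq_zero_of_pow_eq_zero ((mul_eq_zero.1 h').resolve_left hε0)
    exact eval_curve K ℓ m n F hF P 0 (by simp [hP0, hl.ne']) (by simp [hP1, hm.ne'])
      (by simp [hP2, hn.ne'])
  · have e1 := congrArg (aeval P) hg
    simp only [map_sub, map_add, map_mul, map_pow, aeval_X, eg, e3, mul_zero, add_zero] at e1
    have e1 := sub_eq_zero.1 (pow_eq_zero_iff (by omega) |>.1 e1)
    have e3 := sub_eq_zero.1 e3
    have hne : P 1 ^ b₁ * P 2 ^ c₂ ≠ 0 := by rw [← e1]; exact pow_ne_zero _ hP0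
    have hP1 : P 1 ≠ 0 := by
      intro h0; apply hne; rw [h0, zero_pow hb1.ne', zero_mul]
    have hP2 : P 2 ≠ 0 := by
      intro h0; apply hne; rw [h0, zero_pow hc2.ne', mul_zero]
    obtain ⟨t, t0, t1, t2⟩ := exists_param ℓ m n a₁ a₂ b₁ b₂ c₁ c₂ h
      (Units.mk0 (P 0) hP0) (Units.mk0 (P 1) hP1) (Units.mk0 (P 2) hP2)
      (by ext; simpa using e1) (by ext; simpa using e3)
    refine eval_curve K ℓ m n F hF P (t : K) ?_ ?_ ?_
    · simpa using (congrArg Units.val t0).symm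
    · simpa using (congrArg Units.val t1).symm
    · simpa using (congrArg Units.val t2).symm
end

section
/- Let a, b ≥ 2 be integers with b+2 < 2a+1 and gcd(b+2, 2a+1) = 1, and set ℓ = b+2, m = 2a+1, n = ab+b+1. Let γ be the conductor of Γ = ⟨ℓ,m,n⟩ and put d₂ = (2a+1)(b+1), d₃ = 2ab+2b+2. Then γ + ℓ ≤ d₂ − ⌊m/ℓ⌋·ℓ < d₃; in particular d₂ ≥ γ + 2ℓ and d₃ > γ + ℓ. (Lemma 43) -/
/-- Lemma 43: for `ℓ = b+2`, `m = 2a+1`, `n = ab+b+1` with conductor `γ` of `⟨ℓ,m,n⟩`,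
one has `γ + ℓ ≤ d₂ − ⌊m/ℓ⌋·ℓ < d₃`; in particular `d₂ ≥ γ + 2ℓ` and `d₃ > γ + ℓ`. -/
theorem lemma43 (a b : ℕ) (ha : 2 ≤ a) (hb : 2 ≤ b)
    (hlm : b + 2 < 2 * a + 1) (hgcd : Nat.gcd (b + 2) (2 * a + 1) = 1)
    (γ : ℕ)
    (hγ : IsLeast {c : ℕ | ∀ k : ℕ, c ≤ k →
      k ∈ AddSubmonoid.closure ({b + 2, 2 * a + 1, a * b + b + 1} : Set ℕ)} γ) :
    ((γ : ℤ) + (b + 2) ≤ ((2 * a + 1) * (b + 1) : ℤ) -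
        (((2 * a + 1) / (b + 2) : ℕ) : ℤ) * (b + 2) ∧
      ((2 * a + 1) * (b + 1) : ℤ) - (((2 * a + 1) / (b + 2) : ℕ) : ℤ) * (b + 2) <
        (2 * a * b + 2 * b + 2 : ℤ)) ∧
    γ + 2 * (b + 2) ≤ (2 * a + 1) * (b + 1) ∧
    γ + (b + 2) < 2 * a * b + 2 * b + 2 := by
  set S := AddSubmonoid.closure ({b + 2, 2 * a + 1, a * b + b + 1} : Set ℕ) with hS
  have hl : b + 2 ∈ S := AddSubmonoid.subset_closure (by simp)
  have hm : 2 * a + 1 ∈ S := AddSubmonoid.subset_closure (by simp)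
  have hn : a * b + b + 1 ∈ S := AddSubmonoid.subset_closure (by simp)
  have key : ∀ w k : ℕ, w ∈ S → w ≡ k [MOD (b + 2)] → w < k + (b + 2) → k ∈ S := by
    intro w k hw hwk hlt
    have hle : w ≤ k := by
      by_contra hcon
      have hd := (Nat.modEq_iff_dvd' (by omega)).1 hwk.symm
      have := Nat.le_of_dvd (by omega) hd
      omega
    obtain ⟨j, hj⟩ := (Nat.modEq_iff_dvd' hle).1 hwk
    have hk : k = w + j • (b + 2) := by
      rw [smul_eq_mul, mul_comm]; omega
    rw [hk]
    exact S.add_mem hw (S.nsmul_mem hl j)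
  obtain ⟨q, hq⟩ : ∃ q, q = (2 * a + 1) / (b + 2) := ⟨_, rfl⟩
  have hq1 : 1 ≤ q := by
    rw [hq]; exact (Nat.one_le_div_iff (by omega)).2 hlm.le
  have hdm := Nat.div_add_mod (2 * a + 1) (b + 2)
  have hml := Nat.mod_lt (2 * a + 1) (show 0 < b + 2 by omega)
  have hr : 0 < (2 * a + 1) % (b + 2) := by
    rcases Nat.eq_zero_or_pos ((2 * a + 1) % (b + 2)) with h | h
    · have := Nat.gcd_eq_left (Nat.dvd_of_mod_eq_zero h)
      omega
    · exact h
  rw [← hq] at hdm ⊢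
  have hqlt : q * (b + 2) < 2 * a + 1 := by rw [mul_comm]; omega
  have hqgt : 2 * a + 1 < q * (b + 2) + (b + 2) := by rw [mul_comm q]; omega
  have hq2 : b + 2 ≤ q * (b + 2) := Nat.le_mul_of_pos_left _ hq1
  have hab : 2 * b ≤ a * b := Nat.mul_le_mul_right b ha
  have hmem : ∀ k : ℕ, (2 * a + 1) * (b + 1) ≤ k + (b + 2) + q * (b + 2) → k ∈ S := by
    intro k hk
    obtain ⟨y, hy⟩ := Nat.exists_mul_mod_eq_one_of_coprime
      (show Nat.Coprime (2 * a + 1) (b + 2) from (Nat.gcd_comm _ _).trans hgcd) (by omega)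
    obtain ⟨i, hi, hik⟩ : ∃ i < b + 2, i * (2 * a + 1) ≡ k [MOD (b + 2)] := by
      refine ⟨(y * k) % (b + 2), Nat.mod_lt _ (by omega), ?_⟩
      have h1 : (2 * a + 1) * y ≡ 1 [MOD (b + 2)] := by
        unfold Nat.ModEq; rw [hy.2, Nat.mod_eq_of_lt (by omega)]
      calc (y * k) % (b + 2) * (2 * a + 1) ≡ y * k * (2 * a + 1) [MOD (b + 2)] :=
            (Nat.mod_modEq _ _).mul_right _
        _ = (2 * a + 1) * y * k := by ring
        _ ≡ 1 * k [MOD (b + 2)] := h1.mul_right _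
        _ = k := one_mul k
    by_cases hib : i ≤ b
    · refine key _ k (S.nsmul_mem hm i) hik ?_
      have : i * (2 * a + 1) ≤ b * (2 * a + 1) := Nat.mul_le_mul_right _ hib
      rw [smul_eq_mul]
      nlinarith
    · have hib : i = b + 1 := by omega
      subst hib
      refine key _ k hn (Nat.ModEq.trans ?_ hik) (by nlinarith)
      have : (b + 1) * (2 * a + 1) = a * b + b + 1 + a * (b + 2) := by ring
      rw [this]
      unfold Nat.ModEq
      simp
  have hγle : γ ≤ (2 * a + 1) * (b + 1) - ((b + 2) + q * (b + 2)) :=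
    hγ.2 (fun k hk => hmem k (by omega))
  have hbig : (b + 2) + q * (b + 2) ≤ (2 * a + 1) * (b + 1) := by nlinarith
  have h1 : γ + (b + 2) + q * (b + 2) ≤ (2 * a + 1) * (b + 1) := by omega
  have h2 : (2 * a + 1) * (b + 1) < 2 * a * b + 2 * b + 2 + q * (b + 2) := by nlinarith
  refine ⟨⟨?_, ?_⟩, by omega, by omega⟩
  · zify at h1; linarith
  · zify at h2; linarith
end
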